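/- (Degenerate critical position forces symmetry.) In the setting of Theorem 2.3 with fixed direction e ∈ ∂B₁(0), with λ₀ the largest λ at which Situation 1 or Situation 2 occurs and λ* = inf{λ ≥ λ₀ : v_μ ≥ 0 in H^μ for all μ > λ}: if λ* > λ₀, then v_{λ*} ≡ 0 on ℝ^d, i.e. u is symmetric with respect to the hyperplane {x·e = λ*}. -/

import Mathlib

open MeasureTheory Set Filter Metric Asymptotics
open scoped RealInnerProductSpace ENNReal Topology NNReal

noncomputable section

abbrev Rd (d : ℕ) := EuclideanSpace ℝ (Fin d)

/-- The data of a Bernstein function `Ψ` vanishing at `0`, its Lévy measure `𝔪`,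
and the weak scaling conditions. -/
structure PsiSetting (d : ℕ) where
  Ψ : ℝ → ℝ
  m : Measure ℝ
  m_onIoi : m (Set.Iic 0) = 0
  smooth : ContDiffOn ℝ (⊤ : ℕ∞) Ψ (Set.Ioi 0)
  nonneg : ∀ x > (0:ℝ), 0 ≤ Ψ x
  deriv_alt : ∀ n : ℕ, ∀ x > (0:ℝ),
    (-1 : ℝ) ^ (n + 1) * iteratedDerivWithin (n + 1) Ψ (Set.Ioi 0) x ≤ 0
  zero_lim : Filter.Tendsto Ψ (nhdsWithin 0 (Set.Ioi 0)) (nhds 0)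
  levy_rep : ∀ lam > (0:ℝ), Ψ lam = ∫ t, (1 - Real.exp (-lam * t)) ∂m
  a₁ : ℝ
  a₂ : ℝ
  b₁ : ℝ
  b₂ : ℝ
  ha₁ : 0 < a₁
  ha₁₂ : a₁ ≤ a₂
  ha₂ : a₂ < 1
  hb₁ : 1 ≤ b₁
  hb₂ : 1 < b₂
  scaling_lower : ∀ r R : ℝ, 1 ≤ r → r ≤ R → (1 / b₁) * (R / r) ^ a₁ ≤ Ψ R / Ψ r
  scaling_upper : ∀ r R : ℝ, 1 ≤ r → r ≤ R → Ψ R / Ψ r ≤ b₁ * (R / r) ^ a₂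

/-- The jump kernel `j(r) = ∫_0^∞ (4πt)^{-d/2} e^{-r²/(4t)} 𝔪(dt)`. -/
def PsiSetting.j {d : ℕ} (S : PsiSetting d) (r : ℝ) : ℝ :=
  ∫ t, (4 * Real.pi * t) ^ (-(d : ℝ) / 2) * Real.exp (-(r ^ 2) / (4 * t)) ∂S.m

/-- The condition `j(r) ≤ b₂ j(r+1)` for `r ≥ 1`. -/
def PsiSetting.kernelCond {d : ℕ} (S : PsiSetting d) : Prop :=
  ∀ r : ℝ, 1 ≤ r → S.j r ≤ S.b₂ * S.j (r + 1)

/-- The nonlocal operator `Ψ(−Δ)` applied to a test function. -/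
def psiOp {d : ℕ} (S : PsiSetting d) (φ : Rd d → ℝ) (x : Rd d) : ℝ :=
  ∫ z : Rd d,
    (φ x - φ (x + z) + (if ‖z‖ ≤ 1 then ⟪z, gradient φ x⟫ else 0)) * S.j ‖z‖

/-- Admissible test functions at `x`: bounded continuous and C² near `x`. -/
def TestAt {d : ℕ} (x : Rd d) (φ : Rd d → ℝ) : Prop :=
  (∃ M, ∀ y, |φ y| ≤ M) ∧ Continuous φ ∧ ∃ U ∈ nhds x, ContDiffOn ℝ 2 φ U

/-- Viscosity supersolution of `Ψ(−Δ)u + c·u = g` in `Ω`. -/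
def IsSuperSol {d : ℕ} (S : PsiSetting d) (Ω : Set (Rd d)) (c g u : Rd d → ℝ) : Prop :=
  LowerSemicontinuous u ∧
    ∀ x ∈ Ω, ∀ φ : Rd d → ℝ, TestAt x φ → φ x = u x → (∀ y, y ≠ x → φ y < u y) →
      g x ≤ psiOp S φ x + c x * u x

/-- Viscosity subsolution of `Ψ(−Δ)u + c·u = g` in `Ω`. -/
def IsSubSol {d : ℕ} (S : PsiSetting d) (Ω : Set (Rd d)) (c g u : Rd d → ℝ) : Prop :=
  UpperSemicontinuous u ∧
    ∀ x ∈ Ω, ∀ φ : Rd d → ℝ, TestAt x φ → φ x = u x → (∀ y, y ≠ x → u y < φ y) →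
      psiOp S φ x + c x * u x ≤ g x

/-- Viscosity solution of `Ψ(−Δ)u + c·u = g` in `Ω`. -/
def IsSol {d : ℕ} (S : PsiSetting d) (Ω : Set (Rd d)) (c g u : Rd d → ℝ) : Prop :=
  IsSubSol S Ω c g u ∧ IsSuperSol S Ω c g u

/-- `V` is the renewal function of the ascending ladder-height process associated with `Ψ`. -/
structure IsRenewal (Ψ V : ℝ → ℝ) : Prop where
  nonneg : ∀ x, 0 ≤ V x
  zero : ∀ x ≤ (0:ℝ), V x = 0
  cont : ContinuousOn V (Set.Ioi 0)
  mono : StrictMonoOn V (Set.Ioi 0)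
  laplace : ∀ s : ℝ, 0 < s →
    (∫ x in Set.Ioi (0 : ℝ), V x * Real.exp (-s * x)) =
      1 / (s * Real.exp ((1 / Real.pi) *
        ∫ y in Set.Ioi (0 : ℝ), Real.log (Ψ (s * y)) / (1 + y ^ 2)))

/-- `tr_V(u)(x) = t`: the `V`-trace of `u` at the boundary point `x` of `D`. -/
def HasVTrace {d : ℕ} (V : ℝ → ℝ) (D : Set (Rd d)) (u : Rd d → ℝ)
    (x : Rd d) (t : ℝ) : Prop :=
  Filter.Tendsto (fun z => u z / V (Metric.infDist z Dᶜ)) (nhdsWithin x D) (nhds t)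

/-- An open set has C² boundary. -/
def HasC2Boundary {d : ℕ} (D : Set (Rd d)) : Prop :=
  ∀ x ∈ frontier D, ∃ (U : Set (Rd d)) (f : Rd d → ℝ),
    IsOpen U ∧ x ∈ U ∧ ContDiffOn ℝ 2 f U ∧ (∀ y ∈ U, fderiv ℝ f y ≠ 0) ∧
      D ∩ U = {y ∈ U | f y < 0}

/-- A closed set has C² boundary. -/
def HasC2BoundaryClosed {d : ℕ} (G : Set (Rd d)) : Prop :=
  ∀ x ∈ frontier G, ∃ (U : Set (Rd d)) (f : Rd d → ℝ),
    IsOpen U ∧ x ∈ U ∧ ContDiffOn ℝ 2 f U ∧ (∀ y ∈ U, fderiv ℝ f y ≠ 0) ∧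
      G ∩ U = {y ∈ U | f y ≤ 0}

/-- Reflection `R_{λ,e}` across the hyperplane `{x·e = λ}`. -/
def reflAt {d : ℕ} (e : Rd d) (lam : ℝ) (x : Rd d) : Rd d :=
  x - (2 * ⟪x, e⟫ - 2 * lam) • e

/-- The open half-space `H_{λ,e} = {x·e > λ}`. -/
def halfSpace {d : ℕ} (e : Rd d) (lam : ℝ) : Set (Rd d) := {x | lam < ⟪x, e⟫}

/-- A function is antisymmetric with respect to the half-space `H_{λ,e}`. -/
def AntiSym {d : ℕ} (e : Rd d) (lam : ℝ) (u : Rd d → ℝ) : Prop :=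
  ∀ x, u x = - u (reflAt e lam x)

/-- The hyperplane `{x·e = λ}` is orthogonal to `∂G` at `p` (expressed through
a local C² defining function of `G` near `p`). -/
def OrthAt {d : ℕ} (G : Set (Rd d)) (e p : Rd d) : Prop :=
  ∃ (U : Set (Rd d)) (f : Rd d → ℝ), IsOpen U ∧ p ∈ U ∧ ContDiffOn ℝ 2 f U ∧
    fderiv ℝ f p ≠ 0 ∧ G ∩ U = {y ∈ U | f y ≤ 0} ∧ fderiv ℝ f p e = 0

/-- Situation 1: a touching point `p₀ ∈ ∂G ∩ ∂R_{λ,e}(G ∩ H_{λ,e})` away from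
the hyperplane `{x·e = λ}`. -/
def Sit1 {d : ℕ} (G : Set (Rd d)) (e : Rd d) (lam : ℝ) : Prop :=
  ∃ p, p ∈ frontier G ∧
    p ∈ frontier (reflAt e lam '' (G ∩ halfSpace e lam)) ∧ ⟪p, e⟫ ≠ lam

/-- Situation 2: the hyperplane `{x·e = λ}` is orthogonal to `∂G` at some
point `p₀ ∈ ∂G ∩ {x·e = λ}`. -/
def Sit2 {d : ℕ} (G : Set (Rd d)) (e : Rd d) (lam : ℝ) : Prop :=
  ∃ p, p ∈ frontier G ∧ ⟪p, e⟫ = lam ∧ OrthAt G e p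

/-! ### The Lévy measure -/

namespace PsiSetting

variable {d : ℕ} (S : PsiSetting d)

lemma psi_ne_zero {r : ℝ} (hr : 1 ≤ r) : S.Ψ r ≠ 0 := by
  intro h
  have h1 := S.scaling_lower r r hr le_rfl
  have hb := S.hb₁
  rw [h, div_self (by linarith : r ≠ 0), Real.one_rpow] at h1
  have : 0 < 1 / S.b₁ := by positivity
  simp at h1
  linarith

lemma integrable_one_sub_exp {r : ℝ} (hr : 1 ≤ r) :
    Integrable (fun t => 1 - Real.exp (-r * t)) S.m := by
  by_contra h
  exact S.psi_ne_zero hr (by rw [S.levy_rep r (by linarith), integral_undef h])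

lemma ae_pos : ∀ᵐ t ∂S.m, 0 < t := by
  rw [ae_iff]
  convert S.m_onIoi using 2
  ext t
  simp

lemma sigmaFinite : SigmaFinite S.m := by
  have hint := S.integrable_one_sub_exp le_rfl
  refine ⟨⟨⟨fun n : ℕ => {t | 1 / ((n : ℝ) + 1) < 1 - Real.exp (-1 * t)} ∪ Iic 0,
    fun _ => trivial, fun n => ?_, ?_⟩⟩⟩
  · refine (measure_union_le _ _).trans_lt ?_
    rw [S.m_onIoi, add_zero]
    exact hint.measure_gt_lt_top (by positivity)
  · rw [eq_univ_iff_forall]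
    intro t
    rw [mem_iUnion]
    rcases le_or_gt t 0 with ht | ht
    · exact ⟨0, Or.inr ht⟩
    · have : 0 < 1 - Real.exp (-1 * t) := by
        have := Real.exp_lt_exp.2 (show -1 * t < 0 by linarith)
        rw [Real.exp_zero] at this
        linarith
      obtain ⟨n, hn⟩ := exists_nat_one_div_lt this
      exact ⟨n, Or.inl hn⟩

lemma measure_univ_eq_top : S.m univ = ∞ := by
  by_contra hfin
  have : IsFiniteMeasure S.m := ⟨lt_top_iff_ne_top.2 hfin⟩
  have hbd : ∀ r : ℝ, 1 ≤ r → S.Ψ r ≤ S.m.real univ := by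
    intro r hr
    rw [S.levy_rep r (by linarith)]
    calc ∫ t, (1 - Real.exp (-r * t)) ∂S.m ≤ ∫ _, (1 : ℝ) ∂S.m :=
          integral_mono (S.integrable_one_sub_exp hr) (integrable_const _)
            (fun t => by have := Real.exp_pos (-r * t); simp only; linarith)
      _ = S.m.real univ := by simp
  have hpos : 0 < S.Ψ 1 :=
    lt_of_le_of_ne (S.nonneg 1 one_pos) (S.psi_ne_zero le_rfl).symm
  have hb := S.hb₁
  have hlim : Tendsto (fun R : ℝ => (1 / S.b₁) * R ^ S.a₁) atTop atTop :=
    (tendsto_rpow_atTop S.ha₁).const_mul_atTop (by positivity)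
  obtain ⟨R, hR, hR1⟩ := ((hlim.eventually_gt_atTop (S.m.real univ / S.Ψ 1)).and
    (eventually_ge_atTop 1)).exists
  have h1 := S.scaling_lower 1 R le_rfl hR1
  rw [div_one] at h1
  have h2 : S.Ψ R / S.Ψ 1 ≤ S.m.real univ / S.Ψ 1 := by gcongr; exact hbd R hR1
  linarith

/-- The heat kernel whose mixture is the jump kernel. -/
def heat (d : ℕ) (t r : ℝ) : ℝ :=
  (4 * Real.pi * t) ^ (-(d : ℝ) / 2) * Real.exp (-(r ^ 2) / (4 * t))

lemma heat_pos {t : ℝ} (ht : 0 < t) (r : ℝ) : 0 < heat d t r := by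
  unfold heat; positivity

lemma measurable_heat : Measurable (fun p : ℝ × ℝ => heat d p.1 p.2) := by
  unfold heat
  exact ((measurable_const.mul measurable_fst).pow_const _).mul
    (Real.measurable_exp.comp ((measurable_snd.pow_const 2).neg.div
      (measurable_const.mul measurable_fst)))

lemma measurable_heat_left (r : ℝ) : Measurable (fun t : ℝ => heat d t r) :=
  measurable_heat.comp (measurable_id.prodMk measurable_const)

lemma heat_strictAnti {t : ℝ} (ht : 0 < t) {r s : ℝ} (hr : 0 ≤ r) (hrs : r < s) :
    heat d t s < heat d t r := by
  unfold heat
  gcongr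

lemma lintegral_gaussian {b : ℝ} (hb : 0 < b) :
    ∫⁻ z : Rd d, ENNReal.ofReal (Real.exp (-b * ‖z‖ ^ 2)) =
      ENNReal.ofReal ((Real.pi / b) ^ ((d : ℝ) / 2)) := by
  have h := GaussianFourier.integral_rexp_neg_mul_sq_norm (V := Rd d) hb
  rw [finrank_euclideanSpace, Fintype.card_fin] at h
  rw [← h, ofReal_integral_eq_lintegral_ofReal _ (ae_of_all _ fun z => (Real.exp_pos _).le)]
  by_contra hne
  rw [integral_undef hne] at h
  have : 0 < (Real.pi / b) ^ ((d : ℝ) / 2) := by positivity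
  linarith

lemma lintegral_heat {t : ℝ} (ht : 0 < t) :
    ∫⁻ z : Rd d, ENNReal.ofReal (heat d t ‖z‖) = 1 := by
  have hb : 0 < 1 / (4 * t) := by positivity
  calc ∫⁻ z : Rd d, ENNReal.ofReal (heat d t ‖z‖)
      = ∫⁻ z : Rd d, ENNReal.ofReal ((4 * Real.pi * t) ^ (-(d : ℝ) / 2)) *
          ENNReal.ofReal (Real.exp (-(1 / (4 * t)) * ‖z‖ ^ 2)) := by
        refine lintegral_congr fun z => ?_
        rw [← ENNReal.ofReal_mul (by positivity), heat]
        congr 3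
        ring
    _ = 1 := by
        rw [lintegral_const_mul' _ _ ENNReal.ofReal_ne_top, lintegral_gaussian hb,
          ← ENNReal.ofReal_mul (by positivity), neg_div, Real.rpow_neg (by positivity)]
        have : Real.pi / (1 / (4 * t)) = 4 * Real.pi * t := by field_simp
        rw [this, inv_mul_cancel₀ (by positivity), ENNReal.ofReal_one]

lemma sq_mul_heat_le {t : ℝ} (ht : 0 < t) (r : ℝ) :
    r ^ 2 * heat d t r ≤ 8 * 2 ^ ((d : ℝ) / 2) * t * heat d (2 * t) r := by
  unfold heat
  have h1 : (4 * Real.pi * t) ^ (-(d : ℝ) / 2) =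
      2 ^ ((d : ℝ) / 2) * (4 * Real.pi * (2 * t)) ^ (-(d : ℝ) / 2) := by
    rw [show 4 * Real.pi * (2 * t) = 2 * (4 * Real.pi * t) by ring,
      Real.mul_rpow (x := 2) (by norm_num) (by positivity), ← mul_assoc,
      ← Real.rpow_add (by norm_num), show (d : ℝ) / 2 + -(d : ℝ) / 2 = 0 by ring]
    simp
  have h2 : r ^ 2 * Real.exp (-(r ^ 2) / (4 * t)) ≤
      8 * t * Real.exp (-(r ^ 2) / (4 * (2 * t))) := by
    set s := r ^ 2 / (8 * t) with hs
    have e1 : -(r ^ 2) / (4 * t) = -s + -s := by rw [hs]; field_simp; ring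
    have e2 : -(r ^ 2) / (4 * (2 * t)) = -s := by rw [hs]; field_simp; ring
    have e3 : r ^ 2 = 8 * t * s := by rw [hs]; field_simp
    rw [e1, e2, e3, Real.exp_add]
    have h3 : s * Real.exp (-s) ≤ 1 := by
      rw [Real.exp_neg, ← div_eq_mul_inv, div_le_one (Real.exp_pos _)]
      linarith [Real.add_one_le_exp s]
    have h4 := Real.exp_pos (-s)
    have h5 : s * Real.exp (-s) * Real.exp (-s) ≤ 1 * Real.exp (-s) := by gcongr
    nlinarith
  rw [h1]
  have hp : 0 ≤ 2 ^ ((d : ℝ) / 2) * (4 * Real.pi * (2 * t)) ^ (-(d : ℝ) / 2) := by positivity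
  nlinarith [mul_le_mul_of_nonneg_left h2 hp]

lemma exists_lintegral_min_heat_le (d : ℕ) : ∃ C : ℝ, 0 ≤ C ∧ ∀ t : ℝ, 0 < t →
    ∫⁻ z : Rd d, ENNReal.ofReal (min 1 (‖z‖ ^ 2)) * ENNReal.ofReal (heat d t ‖z‖) ≤
      ENNReal.ofReal (C * (1 - Real.exp (-1 * t))) := by
  set K : ℝ := 8 * 2 ^ ((d : ℝ) / 2) with hK
  have hK1 : 1 ≤ K := by
    have : (1 : ℝ) ≤ 2 ^ ((d : ℝ) / 2) := Real.one_le_rpow (by norm_num) (by positivity)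
    linarith
  refine ⟨2 * K, by positivity, fun t ht => ?_⟩
  have hA : ∫⁻ z : Rd d, ENNReal.ofReal (min 1 (‖z‖ ^ 2)) * ENNReal.ofReal (heat d t ‖z‖) ≤
      1 := by
    rw [← lintegral_heat (d := d) ht]
    refine lintegral_mono fun z => ?_
    rw [← ENNReal.ofReal_mul (by positivity)]
    exact ENNReal.ofReal_le_ofReal
      (mul_le_of_le_one_left (heat_pos ht _).le (min_le_left _ _))
  have hB : ∫⁻ z : Rd d, ENNReal.ofReal (min 1 (‖z‖ ^ 2)) * ENNReal.ofReal (heat d t ‖z‖) ≤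
      ENNReal.ofReal (K * t) := by
    calc _ ≤ ∫⁻ z : Rd d, ENNReal.ofReal (K * t) * ENNReal.ofReal (heat d (2 * t) ‖z‖) := by
          refine lintegral_mono fun z => ?_
          rw [← ENNReal.ofReal_mul (by positivity), ← ENNReal.ofReal_mul (by positivity)]
          refine ENNReal.ofReal_le_ofReal ((mul_le_mul_of_nonneg_right (min_le_right _ _)
            (heat_pos ht _).le).trans (sq_mul_heat_le ht _))
      _ = ENNReal.ofReal (K * t) := by
          rw [lintegral_const_mul' _ _ ENNReal.ofReal_ne_top, lintegral_heat (by positivity),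
            mul_one]
  have h1 : t ≤ (1 + t) * (1 - Real.exp (-1 * t)) := by
    have h2 := Real.add_one_le_exp t
    have h3 : Real.exp (-1 * t) * (1 + t) ≤ 1 := by
      rw [neg_one_mul, Real.exp_neg, inv_mul_le_iff₀ (Real.exp_pos _)]; linarith
    linarith
  have h0 : 0 ≤ 1 - Real.exp (-1 * t) := by
    have := Real.exp_le_one_iff.2 (show -1 * t ≤ 0 by linarith)
    linarith
  rcases le_total t 1 with h | h
  · refine hB.trans (ENNReal.ofReal_le_ofReal ?_)
    have h3 : t ≤ 2 * (1 - Real.exp (-1 * t)) := by nlinarith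
    nlinarith
  · refine hA.trans ?_
    rw [← ENNReal.ofReal_one]
    refine ENNReal.ofReal_le_ofReal ?_
    have : 1 ≤ 2 * (1 - Real.exp (-1 * t)) := by
      by_contra! hc
      nlinarith
    nlinarith

/-- The jump kernel as an extended nonnegative integral. -/
def jE (r : ℝ) : ℝ≥0∞ := ∫⁻ t, ENNReal.ofReal (heat d t r) ∂S.m

lemma measurable_jE : Measurable S.jE := by
  have := S.sigmaFinite
  exact Measurable.lintegral_prod_right'
    (f := fun p : ℝ × ℝ => ENNReal.ofReal (heat d p.2 p.1))
    (ENNReal.measurable_ofReal.comp (measurable_heat.comp measurable_swap))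

lemma lintegral_mul_jE (g : ℝ → ℝ≥0∞) (hg : Measurable g) :
    ∫⁻ z : Rd d, g ‖z‖ * S.jE ‖z‖ =
      ∫⁻ t, (∫⁻ z : Rd d, g ‖z‖ * ENNReal.ofReal (heat d t ‖z‖)) ∂S.m := by
  have := S.sigmaFinite
  unfold jE
  rw [lintegral_lintegral_swap]
  · refine lintegral_congr fun z => ?_
    exact (lintegral_const_mul _
      (ENNReal.measurable_ofReal.comp (measurable_heat_left _))).symm
  · refine Measurable.aemeasurable ?_
    refine ((hg.comp measurable_norm).comp measurable_snd).mul (ENNReal.measurable_ofReal.comp ?_)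
    exact measurable_heat.comp (measurable_fst.prodMk (measurable_norm.comp measurable_snd))

lemma lintegral_min_jE_lt_top :
    ∫⁻ z : Rd d, ENNReal.ofReal (min 1 (‖z‖ ^ 2)) * S.jE ‖z‖ < ∞ := by
  obtain ⟨C, -, hC⟩ := exists_lintegral_min_heat_le d
  rw [S.lintegral_mul_jE (fun r => ENNReal.ofReal (min 1 (r ^ 2)))
    (ENNReal.measurable_ofReal.comp (measurable_const.min (measurable_id.pow_const 2)))]
  calc _ ≤ ∫⁻ t, ENNReal.ofReal (C * (1 - Real.exp (-1 * t))) ∂S.m :=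
        lintegral_mono_ae (S.ae_pos.mono fun t ht => hC t ht)
    _ < ∞ := ((S.integrable_one_sub_exp le_rfl).const_mul C).lintegral_lt_top

lemma lintegral_jE : ∫⁻ z : Rd d, S.jE ‖z‖ = ∞ := by
  have h := S.lintegral_mul_jE (fun _ => 1) measurable_const
  simp only [one_mul] at h
  rw [h, lintegral_congr_ae (g := fun _ => 1) (S.ae_pos.mono fun t ht => lintegral_heat ht)]
  simpa using S.measure_univ_eq_top

lemma jE_anti {r s : ℝ} (hr : 0 ≤ r) (hrs : r ≤ s) : S.jE s ≤ S.jE r := by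
  refine lintegral_mono_ae (S.ae_pos.mono fun t ht => ENNReal.ofReal_le_ofReal ?_)
  rcases hrs.eq_or_lt with rfl | h
  · exact le_rfl
  · exact (heat_strictAnti ht hr h).le

lemma jE_lt_top (hd : 0 < d) {r : ℝ} (hr : 0 < r) : S.jE r < ∞ := by
  have : NeZero d := ⟨hd.ne'⟩
  by_contra htop
  rw [not_lt, top_le_iff] at htop
  have hall : ∀ s : ℝ, 0 ≤ s → s ≤ r → S.jE s = ∞ := fun s hs hsr =>
    top_le_iff.1 (htop ▸ S.jE_anti hs hsr)
  have hae := ae_lt_top ((ENNReal.measurable_ofReal.comp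
    (measurable_const.min (measurable_norm.pow_const 2))).mul
      (S.measurable_jE.comp measurable_norm)) S.lintegral_min_jE_lt_top.ne
  have hball : (volume : Measure (Rd d)) (ball 0 r \ {0}) = 0 := by
    refine measure_mono_null ?_ (ae_iff.1 hae)
    rintro z ⟨hz, hz0⟩
    rw [mem_ball_zero_iff] at hz
    have hz0' : 0 < ‖z‖ := norm_pos_iff.2 hz0
    simp only [mem_ofPred_eq, not_lt, top_le_iff, Pi.mul_apply, Function.comp]
    rw [hall _ (norm_nonneg _) hz.le, ENNReal.mul_top]
    have : 0 < min 1 (‖z‖ ^ 2) := by positivity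
    exact (ENNReal.ofReal_pos.2 this).ne'
  rw [measure_sdiff_null (measure_singleton _)] at hball
  exact (measure_ball_pos volume (0 : Rd d) hr).ne' hball

lemma integrable_heat (hd : 0 < d) {r : ℝ} (hr : 0 < r) :
    Integrable (fun t => heat d t r) S.m := by
  refine ⟨(measurable_heat_left r).aestronglyMeasurable, ?_⟩
  rw [hasFiniteIntegral_iff_ofReal (S.ae_pos.mono fun _ ht => (heat_pos ht r).le)]
  exact S.jE_lt_top hd hr

lemma j_eq_toReal (r : ℝ) : S.j r = (S.jE r).toReal :=
  integral_eq_lintegral_of_nonneg_ae (S.ae_pos.mono fun _ ht => (heat_pos ht r).le)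
    (measurable_heat_left r).aestronglyMeasurable

lemma ofReal_j (hd : 0 < d) {r : ℝ} (hr : 0 < r) : ENNReal.ofReal (S.j r) = S.jE r := by
  rw [j_eq_toReal, ENNReal.ofReal_toReal (S.jE_lt_top hd hr).ne]

lemma measurable_j : Measurable S.j := by
  rw [show S.j = fun r => (S.jE r).toReal from funext S.j_eq_toReal]
  exact S.measurable_jE.ennreal_toReal

lemma j_nonneg (r : ℝ) : 0 ≤ S.j r := by
  rw [j_eq_toReal]; exact ENNReal.toReal_nonneg

lemma integral_pos_of_ae_pos {g : ℝ → ℝ} (hg : Integrable g S.m) (hpos : ∀ t, 0 < t → 0 < g t) :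
    0 < ∫ t, g t ∂S.m := by
  rw [integral_pos_iff_support_of_nonneg_ae (S.ae_pos.mono fun t ht => (hpos t ht).le) hg]
  refine pos_iff_ne_zero.2 fun h => ?_
  have h1 : S.m univ ≤ 0 := by
    rw [← add_zero (0 : ℝ≥0∞)]
    nth_rw 1 [← h]
    rw [← S.m_onIoi]
    refine (measure_mono fun (t : ℝ) (_ : t ∈ univ) => ?_).trans (measure_union_le _ _)
    rcases le_or_gt t 0 with ht | ht
    · exact Or.inr ht
    · exact Or.inl (hpos t ht).ne'
  rw [S.measure_univ_eq_top] at h1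
  simp at h1

lemma j_pos (hd : 0 < d) {r : ℝ} (hr : 0 < r) : 0 < S.j r :=
  S.integral_pos_of_ae_pos (S.integrable_heat hd hr) fun _ ht => heat_pos ht r

lemma j_strictAnti (hd : 0 < d) {r s : ℝ} (hr : 0 < r) (hrs : r < s) : S.j s < S.j r := by
  have h1 := S.integrable_heat hd hr
  have h2 := S.integrable_heat hd (hr.trans hrs)
  have h := S.integral_pos_of_ae_pos (h1.sub h2)
    fun t ht => sub_pos.2 (heat_strictAnti ht hr.le hrs)
  simp only [Pi.sub_apply] at h
  rw [integral_sub h1 h2] at h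
  exact sub_pos.1 h

lemma j_anti (hd : 0 < d) {r s : ℝ} (hr : 0 < r) (hrs : r ≤ s) : S.j s ≤ S.j r := by
  rcases hrs.eq_or_lt with rfl | h
  · exact le_rfl
  · exact (S.j_strictAnti hd hr h).le

lemma measurable_j_norm : Measurable (fun z : Rd d => S.j ‖z‖) :=
  S.measurable_j.comp measurable_norm

lemma ae_ofReal_j_norm (hd : 0 < d) :
    ∀ᵐ z : Rd d, ENNReal.ofReal (S.j ‖z‖) = S.jE ‖z‖ := by
  have : NeZero d := ⟨hd.ne'⟩
  filter_upwards [compl_mem_ae_iff.2 (measure_singleton (0 : Rd d))] with z hz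
  exact S.ofReal_j hd (norm_pos_iff.2 hz)

lemma integrable_min_mul_j (hd : 0 < d) :
    Integrable (fun z : Rd d => min 1 (‖z‖ ^ 2) * S.j ‖z‖) := by
  refine ⟨((measurable_const.min (measurable_norm.pow_const 2)).mul
    S.measurable_j_norm).aestronglyMeasurable, ?_⟩
  rw [hasFiniteIntegral_iff_ofReal
    (ae_of_all _ fun z => mul_nonneg (by positivity) (S.j_nonneg _))]
  rw [lintegral_congr_ae (g := fun z : Rd d =>
    ENNReal.ofReal (min 1 (‖z‖ ^ 2)) * S.jE ‖z‖)]
  · exact S.lintegral_min_jE_lt_top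
  · filter_upwards [S.ae_ofReal_j_norm hd] with z hz
    rw [ENNReal.ofReal_mul (by positivity), hz]

lemma lintegral_j (hd : 0 < d) : ∫⁻ z : Rd d, ENNReal.ofReal (S.j ‖z‖) = ∞ := by
  rw [lintegral_congr_ae (S.ae_ofReal_j_norm hd), S.lintegral_jE]

lemma integrableOn_sq_mul_j (hd : 0 < d) {r : ℝ} (hr : r ≤ 1) :
    IntegrableOn (fun z : Rd d => ‖z‖ ^ 2 * S.j ‖z‖) (ball 0 r) := by
  refine (S.integrable_min_mul_j hd).integrableOn.congr_fun (fun z hz => ?_) measurableSet_ball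
  rw [mem_ball_zero_iff] at hz
  have : min 1 (‖z‖ ^ 2) = ‖z‖ ^ 2 := min_eq_right (by nlinarith [norm_nonneg z])
  simp only [this]

lemma integrableOn_j (hd : 0 < d) {r : ℝ} (hr : 0 < r) :
    IntegrableOn (fun z : Rd d => S.j ‖z‖) (ball 0 r)ᶜ := by
  have h := ((S.integrable_min_mul_j hd).integrableOn (s := (ball (0 : Rd d) r)ᶜ)).const_mul
    (min 1 (r ^ 2))⁻¹
  refine h.mono' S.measurable_j_norm.aestronglyMeasurable ?_
  refine (ae_restrict_iff' measurableSet_ball.compl).2 (ae_of_all _ fun z hz => ?_)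
  rw [mem_compl_iff, mem_ball_zero_iff, not_lt] at hz
  rw [Real.norm_of_nonneg (S.j_nonneg _), ← mul_assoc]
  refine le_mul_of_one_le_left (S.j_nonneg _) ?_
  have hm : 0 < min 1 (r ^ 2) := by positivity
  rw [inv_mul_eq_div, one_le_div hm]
  gcongr

end PsiSetting

/-! ### Testing viscosity solutions with paraboloids -/

lemma integral_compl_ball_eq_zero_of_odd {d : ℕ} {F : Rd d → ℝ} (hF : ∀ z, F (-z) = -F z)
    (r : ℝ) : ∫ z in (ball 0 r)ᶜ, F z = 0 := by
  rw [← integral_indicator measurableSet_ball.compl]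
  have h := integral_neg_eq_self ((ball (0 : Rd d) r)ᶜ.indicator F) volume
  have h2 : (fun z => (ball (0 : Rd d) r)ᶜ.indicator F (-z)) =
      fun z => -(ball (0 : Rd d) r)ᶜ.indicator F z := by
    funext z
    by_cases hz : z ∈ (ball (0 : Rd d) r)ᶜ
    · have hz' : -z ∈ (ball (0 : Rd d) r)ᶜ := by simpa using hz
      rw [indicator_of_mem hz, indicator_of_mem hz', hF]
    · have hz' : -z ∉ (ball (0 : Rd d) r)ᶜ := by simpa using hz
      rw [indicator_of_notMem hz, indicator_of_notMem hz', neg_zero]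
  rw [h2, integral_neg] at h
  linarith

lemma hasGradientAt_paraboloid {d : ℕ} (x p : Rd d) (a C : ℝ) :
    HasGradientAt (fun y => a + ⟪y - x, p⟫ - C * ‖y - x‖ ^ 2) p x := by
  rw [hasGradientAt_iff_hasFDerivAt]
  have h1 : HasFDerivAt (fun y : Rd d => y - x) (ContinuousLinearMap.id ℝ (Rd d)) x :=
    (hasFDerivAt_id x).sub_const x
  have h2 := ((h1.inner ℝ (hasFDerivAt_const p x)).const_add a).sub (h1.norm_sq.const_mul C)
  refine h2.congr_fderiv ?_
  ext v
  simp [real_inner_comm]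

/-- A cutoff equal to `1` on the ball of radius `r` and to `0` away from it. -/
def radialCutoff (r δ s : ℝ) : ℝ := max 0 (min 1 (1 - (s - r) / δ))

lemma radialCutoff_nonneg (r δ s : ℝ) : 0 ≤ radialCutoff r δ s := le_max_left _ _

lemma radialCutoff_le_one (r δ s : ℝ) : radialCutoff r δ s ≤ 1 :=
  max_le zero_le_one (min_le_left _ _)

lemma radialCutoff_eq_one {r δ s : ℝ} (hδ : 0 < δ) (hs : s ≤ r) : radialCutoff r δ s = 1 := by
  have : (s - r) / δ ≤ 0 := div_nonpos_of_nonpos_of_nonneg (by linarith) hδ.le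
  rw [radialCutoff, min_eq_left (by linarith), max_eq_right zero_le_one]

lemma radialCutoff_eq_zero {r δ s : ℝ} (hδ : 0 < δ) (hs : r + δ ≤ s) :
    radialCutoff r δ s = 0 := by
  have : 1 ≤ (s - r) / δ := by rw [one_le_div hδ]; linarith
  exact max_eq_left ((min_le_right _ _).trans (by linarith))

lemma continuous_radialCutoff (r δ : ℝ) : Continuous (radialCutoff r δ) := by
  unfold radialCutoff; fun_prop

section Paraboloid

variable {d : ℕ}

/-- The test function which is a paraboloid near `x` and a small perturbation of `u` away
from `x`. -/
def gluedTest (u : Rd d → ℝ) (x p : Rd d) (C r δ ε : ℝ) (y : Rd d) : ℝ :=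
  radialCutoff r δ ‖y - x‖ * (u x + ⟪y - x, p⟫ - (C + ε) * ‖y - x‖ ^ 2) +
    (1 - radialCutoff r δ ‖y - x‖) * (u y - ε * min 1 (‖y - x‖ ^ 2))

variable {u : Rd d → ℝ} {x p : Rd d} {M C ρ r δ ε : ℝ}

lemma gluedTest_of_le (hδ : 0 < δ) {y : Rd d} (hy : ‖y - x‖ ≤ r) :
    gluedTest u x p C r δ ε y = u x + ⟪y - x, p⟫ - (C + ε) * ‖y - x‖ ^ 2 := by
  rw [gluedTest, radialCutoff_eq_one hδ hy]; ring

lemma gluedTest_of_ge (hδ : 0 < δ) {y : Rd d} (hy : r + δ ≤ ‖y - x‖) :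
    gluedTest u x p C r δ ε y = u y - ε * min 1 (‖y - x‖ ^ 2) := by
  rw [gluedTest, radialCutoff_eq_zero hδ hy]; ring

lemma continuous_gluedTest (hu : Continuous u) : Continuous (gluedTest u x p C r δ ε) := by
  have h : Continuous (fun y => radialCutoff r δ ‖y - x‖) :=
    (continuous_radialCutoff r δ).comp (by fun_prop)
  unfold gluedTest
  fun_prop

lemma abs_gluedTest_le (hM : ∀ y, |u y| ≤ M) (hC : 0 ≤ C) (hδ : 0 < δ) (hε : 0 ≤ ε)
    (hε1 : ε ≤ 1) (hrδ : r + δ ≤ 1) (y : Rd d) :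
    |gluedTest u x p C r δ ε y| ≤ M + ‖p‖ + C + 1 := by
  have hp := norm_nonneg p
  set η := radialCutoff r δ ‖y - x‖ with hη
  have h0 : 0 ≤ η := radialCutoff_nonneg _ _ _
  have h1 : η ≤ 1 := radialCutoff_le_one _ _ _
  have hb : |u y - ε * min 1 (‖y - x‖ ^ 2)| ≤ M + ‖p‖ + C + 1 := by
    have hm0 : 0 ≤ min 1 (‖y - x‖ ^ 2) := by positivity
    have hm1 : min 1 (‖y - x‖ ^ 2) ≤ 1 := min_le_left _ _
    have := abs_le.1 (hM y)
    have h3 : ε * min 1 (‖y - x‖ ^ 2) ≤ 1 := mul_le_one₀ hε1 hm0 hm1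
    have h4 : 0 ≤ ε * min 1 (‖y - x‖ ^ 2) := by positivity
    rw [abs_le]; constructor <;> linarith
  rcases le_or_gt (r + δ) ‖y - x‖ with h | h
  · rwa [gluedTest_of_ge hδ h]
  · have hy1 : ‖y - x‖ ≤ 1 := by linarith
    have ha : |u x + ⟪y - x, p⟫ - (C + ε) * ‖y - x‖ ^ 2| ≤ M + ‖p‖ + C + 1 := by
      have h2 := abs_le.1 (hM x)
      have h3 : |⟪y - x, p⟫| ≤ ‖p‖ :=
        (abs_real_inner_le_norm _ _).trans (mul_le_of_le_one_left hp hy1)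
      have h4 := abs_le.1 h3
      have h5 : (C + ε) * ‖y - x‖ ^ 2 ≤ C + 1 := by
        have : ‖y - x‖ ^ 2 ≤ 1 := pow_le_one₀ (norm_nonneg _) hy1
        nlinarith
      have h6 : 0 ≤ (C + ε) * ‖y - x‖ ^ 2 := by positivity
      rw [abs_le]; constructor <;> linarith
    rw [gluedTest, ← hη]
    calc _ ≤ |η * (u x + ⟪y - x, p⟫ - (C + ε) * ‖y - x‖ ^ 2)| +
          |(1 - η) * (u y - ε * min 1 (‖y - x‖ ^ 2))| := abs_add_le _ _
      _ ≤ η * (M + ‖p‖ + C + 1) + (1 - η) * (M + ‖p‖ + C + 1) := by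
          rw [abs_mul, abs_mul, abs_of_nonneg h0, abs_of_nonneg (sub_nonneg.2 h1)]
          gcongr
      _ = _ := by ring

lemma gluedTest_lt (hδ : 0 < δ) (hε : 0 < ε) (hrδ : r + δ ≤ ρ)
    (hT : ∀ z, ‖z‖ ≤ ρ → u x + ⟪z, p⟫ - C * ‖z‖ ^ 2 ≤ u (x + z)) {y : Rd d} (hy : y ≠ x) :
    gluedTest u x p C r δ ε y < u y := by
  have hn : 0 < ‖y - x‖ := norm_pos_iff.2 (sub_ne_zero.2 hy)
  have hb : u y - ε * min 1 (‖y - x‖ ^ 2) < u y := by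
    have : 0 < ε * min 1 (‖y - x‖ ^ 2) := by positivity
    linarith
  rcases le_or_gt (r + δ) ‖y - x‖ with h | h
  · rwa [gluedTest_of_ge hδ h]
  · have ha : u x + ⟪y - x, p⟫ - (C + ε) * ‖y - x‖ ^ 2 < u y := by
      have h1 := hT (y - x) (by linarith)
      rw [add_sub_cancel] at h1
      have : 0 < ε * ‖y - x‖ ^ 2 := by positivity
      nlinarith
    have h0 := radialCutoff_nonneg r δ ‖y - x‖
    have h1 := radialCutoff_le_one r δ ‖y - x‖
    rw [gluedTest]
    generalize radialCutoff r δ ‖y - x‖ = η at *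
    rcases h0.eq_or_lt with rfl | h0
    · linarith
    · nlinarith

lemma gluedTest_eventuallyEq (hδ : 0 < δ) (hr : 0 < r) :
    gluedTest u x p C r δ ε =ᶠ[𝓝 x]
      fun y => u x + ⟪y - x, p⟫ - (C + ε) * ‖y - x‖ ^ 2 := by
  filter_upwards [ball_mem_nhds x hr] with y hy
  exact gluedTest_of_le hδ (mem_ball_iff_norm.1 hy).le

lemma testAt_gluedTest (hu : Continuous u) (hM : ∀ y, |u y| ≤ M) (hC : 0 ≤ C) (hr : 0 < r)
    (hδ : 0 < δ) (hε : 0 ≤ ε) (hε1 : ε ≤ 1) (hrδ : r + δ ≤ 1) :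
    TestAt x (gluedTest u x p C r δ ε) := by
  refine ⟨⟨_, abs_gluedTest_le hM hC hδ hε hε1 hrδ⟩, continuous_gluedTest hu, ball x r,
    ball_mem_nhds x hr, ?_⟩
  have : ContDiff ℝ 2 (fun y : Rd d => u x + ⟪y - x, p⟫ - (C + ε) * ‖y - x‖ ^ 2) := by
    refine ContDiff.sub (contDiff_const.add ?_) (contDiff_const.mul ?_)
    · exact ContDiff.inner ℝ (contDiff_id.sub contDiff_const) contDiff_const
    · exact (contDiff_id.sub contDiff_const).norm_sq ℝ
  exact this.contDiffOn.congr fun y hy => gluedTest_of_le hδ (mem_ball_iff_norm.1 hy).le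

end Paraboloid

namespace PsiSetting

variable {d : ℕ} (S : PsiSetting d)

lemma integrableOn_bdd_mul_j (hd : 0 < d) {r K : ℝ} (hr : 0 < r) {F : Rd d → ℝ}
    (hF : Measurable F) (hK : ∀ z, |F z| ≤ K) :
    IntegrableOn (fun z => F z * S.j ‖z‖) (ball 0 r)ᶜ :=
  (S.integrableOn_j hd hr).bdd_mul hF.aestronglyMeasurable (ae_of_all _ hK)

open Classical in
/-- A viscosity supersolution touched from below at `x` by a paraboloid satisfies the
equation there, with the paraboloid replacing the function near `x`. -/
lemma le_of_isSuperSol (hd : 0 < d) {Ω : Set (Rd d)} {g u : Rd d → ℝ} {M : ℝ}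
    (hu : Continuous u) (hM : ∀ y, |u y| ≤ M) (hs : IsSuperSol S Ω (fun _ => 0) g u)
    {x p : Rd d} (hx : x ∈ Ω) {C ρ r : ℝ} (hC : 0 ≤ C) (hρ : ρ ≤ 1)
    (hT : ∀ z, ‖z‖ ≤ ρ → u x + ⟪z, p⟫ - C * ‖z‖ ^ 2 ≤ u (x + z)) (hr : 0 < r) (hrρ : r < ρ) :
    g x ≤ C * (∫ z in ball (0 : Rd d) r, ‖z‖ ^ 2 * S.j ‖z‖) +
      ∫ z in (ball 0 r)ᶜ, (u x - u (x + z)) * S.j ‖z‖ := by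
  have : NeZero d := ⟨hd.ne'⟩
  set ε : ℕ → ℝ := fun n => 1 / ((n : ℝ) + 1) with hε
  have hε0 : ∀ n, 0 < ε n := fun n => by positivity
  have hε1 : ∀ n, ε n ≤ 1 := fun n => by
    simp only [hε]
    rw [div_le_one (by positivity)]
    linarith [(Nat.cast_nonneg n : (0 : ℝ) ≤ n)]
  have hεlim : Tendsto ε atTop (𝓝 0) := tendsto_one_div_add_atTop_nhds_zero_nat
  set δ : ℕ → ℝ := fun n => (ρ - r) * ε n with hδ
  have hδ0 : ∀ n, 0 < δ n := fun n => mul_pos (by linarith) (hε0 n)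
  have hδρ : ∀ n, r + δ n ≤ ρ := fun n => by
    have := mul_le_of_le_one_right (by linarith : 0 ≤ ρ - r) (hε1 n)
    simp only [hδ]; linarith
  have hδlim : Tendsto δ atTop (𝓝 0) := by simpa using hεlim.const_mul (ρ - r)
  set φ : ℕ → Rd d → ℝ := fun n => gluedTest u x p C r (δ n) (ε n) with hφ
  have hφx : ∀ n, φ n x = u x := fun n => by
    simp only [hφ]
    rw [gluedTest_of_le (hδ0 n) (by simpa using hr.le)]
    simp
  have hgrad : ∀ n, gradient (φ n) x = p := fun n =>
    ((hasGradientAt_paraboloid x p (u x) (C + ε n)).congr_of_eventuallyEq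
      (gluedTest_eventuallyEq (hδ0 n) hr)).gradient
  have hbase : ∀ n, g x ≤ psiOp S (φ n) x := fun n => by
    have h := hs.2 x hx (φ n) (testAt_gluedTest hu hM hC hr (hδ0 n) (hε0 n).le (hε1 n)
      ((hδρ n).trans hρ)) (hφx n) (fun y hy => gluedTest_lt (hδ0 n) (hε0 n) (hδρ n) hT hy)
    simpa using h
  set K : ℝ := M + (M + ‖p‖ + C + 1) + ‖p‖ with hK
  have hM0 : 0 ≤ M := (abs_nonneg _).trans (hM x)
  have hK0 : 0 ≤ K := by positivity
  have hlin : ∀ z : Rd d, |if ‖z‖ ≤ 1 then ⟪z, p⟫ else 0| ≤ ‖p‖ := fun z => by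
    split_ifs with hz
    · exact (abs_real_inner_le_norm _ _).trans (mul_le_of_le_one_left (norm_nonneg _) hz)
    · simp
  have hlinm : Measurable (fun z : Rd d => if ‖z‖ ≤ 1 then ⟪z, p⟫ else 0) :=
    Measurable.ite (measurableSet_le measurable_norm measurable_const)
      (by fun_prop) measurable_const
  set F : Rd d → ℝ := (ball 0 r).piecewise (fun z => C * (‖z‖ ^ 2 * S.j ‖z‖))
    (fun z => (u x - u (x + z) + (if ‖z‖ ≤ 1 then ⟪z, p⟫ else 0)) * S.j ‖z‖) with hF
  have hsphere : ∀ᵐ z : Rd d, ‖z‖ ≠ r := by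
    filter_upwards [compl_mem_ae_iff.2 (Measure.addHaar_sphere volume (0 : Rd d) r)] with z hz
    simpa using hz
  have hlim : Tendsto (fun n => psiOp S (φ n) x) atTop (𝓝 (∫ z, F z)) := by
    refine tendsto_integral_of_dominated_convergence
      (fun z => (C + 1 + K / r ^ 2) * (min 1 (‖z‖ ^ 2) * S.j ‖z‖)) (fun n => ?_)
      ((S.integrable_min_mul_j hd).const_mul _) (fun n => ae_of_all _ fun z => ?_) ?_
    · rw [hgrad, hφx]
      have hc : Continuous (φ n) := continuous_gluedTest hu
      exact (((measurable_const.sub (hc.comp (continuous_const_add x)).measurable).add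
        hlinm).mul S.measurable_j_norm).aestronglyMeasurable
    · rw [hgrad, hφx, norm_mul, Real.norm_of_nonneg (S.j_nonneg _), ← mul_assoc]
      refine mul_le_mul_of_nonneg_right ?_ (S.j_nonneg _)
      rw [Real.norm_eq_abs]
      rcases lt_or_ge ‖z‖ r with hz | hz
      · have hz1 : ‖z‖ ≤ 1 := by linarith
        have hmin : min 1 (‖z‖ ^ 2) = ‖z‖ ^ 2 :=
          min_eq_right (pow_le_one₀ (norm_nonneg _) hz1)
        simp only [hφ]
        rw [gluedTest_of_le (hδ0 n) (by simpa using hz.le), if_pos hz1, hmin, add_sub_cancel_left,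
          show u x - (u x + ⟪z, p⟫ - (C + ε n) * ‖z‖ ^ 2) + ⟪z, p⟫ = (C + ε n) * ‖z‖ ^ 2 by ring,
          abs_of_nonneg (by have := hε0 n; positivity)]
        refine mul_le_mul_of_nonneg_right ?_ (by positivity)
        have : 0 ≤ K / r ^ 2 := by positivity
        linarith [hε1 n]
      · have h1 := abs_gluedTest_le (x := x) (p := p) hM hC (hδ0 n) (hε0 n).le (hε1 n)
          ((hδρ n).trans hρ) (x + z)
        have h2 : |u x - φ n (x + z) + (if ‖z‖ ≤ 1 then ⟪z, p⟫ else 0)| ≤ K :=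
          (abs_add_le _ _).trans (add_le_add ((abs_sub _ _).trans (add_le_add (hM x) h1)) (hlin z))
        refine h2.trans ?_
        have hr2 : r ^ 2 ≤ min 1 (‖z‖ ^ 2) :=
          le_min (pow_le_one₀ hr.le (by linarith)) (by gcongr)
        calc K = K / r ^ 2 * r ^ 2 := by field_simp
          _ ≤ (C + 1 + K / r ^ 2) * min 1 (‖z‖ ^ 2) := by gcongr; linarith
    · filter_upwards [hsphere] with z hz
      simp only [hgrad, hφx]
      rcases lt_or_gt_of_ne hz with hz | hz
      · have hz1 : ‖z‖ ≤ 1 := by linarith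
        rw [hF, piecewise_eq_of_mem _ _ _ (by simpa using hz)]
        have : ∀ n, (u x - φ n (x + z) + if ‖z‖ ≤ 1 then ⟪z, p⟫ else 0) * S.j ‖z‖ =
            (C + ε n) * (‖z‖ ^ 2 * S.j ‖z‖) := fun n => by
          simp only [hφ]
          rw [gluedTest_of_le (hδ0 n) (by simpa using hz.le), if_pos hz1, add_sub_cancel_left]
          ring
        simp only [this]
        simpa using (hεlim.const_add C).mul_const (‖z‖ ^ 2 * S.j ‖z‖)
      · rw [hF, piecewise_eq_of_notMem _ _ _ (by simpa using hz.le)]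
        refine ((Tendsto.const_sub _ ?_).add_const _).mul_const _
        have hev : ∀ᶠ n in atTop, φ n (x + z) = u (x + z) - ε n * min 1 (‖z‖ ^ 2) := by
          filter_upwards [hδlim.eventually_lt_const (sub_pos.2 hz)] with n hn
          simp only [hφ]
          rw [gluedTest_of_ge (hδ0 n) (by rw [add_sub_cancel_left]; linarith),
            add_sub_cancel_left]
        refine Tendsto.congr' (EventuallyEq.symm hev) ?_
        simpa using (hεlim.mul_const (min 1 (‖z‖ ^ 2))).const_sub (u (x + z))
  have hfin := ge_of_tendsto' hlim hbase
  refine hfin.trans_eq ?_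
  have hum : Measurable (fun z => u x - u (x + z)) :=
    measurable_const.sub (hu.comp (continuous_const_add x)).measurable
  have hub : ∀ z, |u x - u (x + z)| ≤ M + M := fun z =>
    (abs_sub _ _).trans (add_le_add (hM x) (hM _))
  have hi1 := S.integrableOn_bdd_mul_j hd hr hum hub
  have hi2 := S.integrableOn_bdd_mul_j hd hr hlinm hlin
  rw [hF, integral_piecewise measurableSet_ball
    ((S.integrableOn_sq_mul_j hd (by linarith)).const_mul C)
    ((hi1.add hi2).congr_fun (fun z _ => by simp only [Pi.add_apply]; ring)
      measurableSet_ball.compl), integral_const_mul]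
  congr 1
  simp only [add_mul]
  rw [integral_add hi1 hi2,
    integral_compl_ball_eq_zero_of_odd (F := fun z => (if ‖z‖ ≤ 1 then ⟪z, p⟫ else 0) * S.j ‖z‖),
    add_zero]
  intro z
  simp only [norm_neg, inner_neg_left]
  split_ifs <;> ring

lemma psiOp_neg (φ : Rd d → ℝ) (x : Rd d) : psiOp S (fun y => -φ y) x = -psiOp S φ x := by
  have hg : gradient (fun y => -φ y) x = -gradient φ x := by
    simp [gradient, fderiv_fun_neg]
  unfold psiOp
  rw [hg, ← integral_neg]
  refine integral_congr_ae (ae_of_all _ fun z => ?_)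
  simp only [inner_neg_right]
  split_ifs <;> ring

lemma isSuperSol_neg {Ω : Set (Rd d)} {g u : Rd d → ℝ}
    (hs : IsSubSol S Ω (fun _ => 0) g u) (hu : Continuous u) :
    IsSuperSol S Ω (fun _ => 0) (fun x => -g x) (fun x => -u x) := by
  refine ⟨hu.neg.lowerSemicontinuous, fun x hx φ hφ hφx hlt => ?_⟩
  obtain ⟨⟨M, hM⟩, hc, U, hU, hC2⟩ := hφ
  have h := hs.2 x hx (fun y => -φ y) ⟨⟨M, fun y => by rw [abs_neg]; exact hM y⟩, hc.neg, U, hU,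
    hC2.neg⟩ (by simp [hφx]) (fun y hy => by linarith [hlt y hy])
  rw [psiOp_neg] at h
  linarith

lemma le_of_isSubSol (hd : 0 < d) {Ω : Set (Rd d)} {g u : Rd d → ℝ} {M : ℝ}
    (hu : Continuous u) (hM : ∀ y, |u y| ≤ M) (hs : IsSubSol S Ω (fun _ => 0) g u)
    {x p : Rd d} (hx : x ∈ Ω) {C ρ r : ℝ} (hC : 0 ≤ C) (hρ : ρ ≤ 1)
    (hT : ∀ z, ‖z‖ ≤ ρ → u (x + z) ≤ u x + ⟪z, p⟫ + C * ‖z‖ ^ 2) (hr : 0 < r) (hrρ : r < ρ) :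
    (∫ z in (ball 0 r)ᶜ, (u x - u (x + z)) * S.j ‖z‖) -
      C * (∫ z in ball (0 : Rd d) r, ‖z‖ ^ 2 * S.j ‖z‖) ≤ g x := by
  have h := S.le_of_isSuperSol hd (u := fun y => -u y) (p := -p) hu.neg (M := M)
    (fun y => by rw [abs_neg]; exact hM y) (S.isSuperSol_neg hs hu) hx hC hρ
    (fun z hz => by have := hT z hz; rw [inner_neg_right]; linarith) hr hrρ
  have h2 : (∫ z in (ball 0 r)ᶜ, (-u x - -u (x + z)) * S.j ‖z‖) =
      -∫ z in (ball 0 r)ᶜ, (u x - u (x + z)) * S.j ‖z‖ := by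
    rw [← integral_neg]
    congr 1
    funext z
    ring
  rw [h2] at h
  linarith

end PsiSetting

/-! ### Reflections -/

section Reflection

variable {d : ℕ} {e : Rd d}

lemma reflAt_eq (he : ‖e‖ = 1) (lam : ℝ) (x : Rd d) :
    reflAt e lam x = (ℝ ∙ e)ᗮ.reflection x + (2 * lam) • e := by
  rw [Submodule.reflection_orthogonal_apply, Submodule.reflection_singleton_apply, he, reflAt]
  simp only [real_inner_comm, RCLike.ofReal_real_eq_id, id_eq]
  module

lemma reflAt_add (lam : ℝ) (x z : Rd d) :
    reflAt e lam (x + z) = reflAt e lam x + reflAt e 0 z := by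
  simp only [reflAt, inner_add_left]
  module

lemma inner_reflAt (he : ‖e‖ = 1) (lam : ℝ) (x : Rd d) :
    ⟪reflAt e lam x, e⟫ = 2 * lam - ⟪x, e⟫ := by
  rw [reflAt, inner_sub_left, real_inner_smul_left, real_inner_self_eq_norm_sq, he]
  ring

lemma reflAt_reflAt (he : ‖e‖ = 1) (lam : ℝ) (x : Rd d) :
    reflAt e lam (reflAt e lam x) = x := by
  rw [reflAt, inner_reflAt he, reflAt]
  module

lemma reflAt_zero_eq (he : ‖e‖ = 1) (x : Rd d) : reflAt e 0 x = (ℝ ∙ e)ᗮ.reflection x := by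
  simp [reflAt_eq he]

lemma norm_reflAt_zero (he : ‖e‖ = 1) (x : Rd d) : ‖reflAt e 0 x‖ = ‖x‖ := by
  rw [reflAt_zero_eq he, LinearIsometryEquiv.norm_map]

lemma inner_reflAt_zero_left (x y : Rd d) : ⟪reflAt e 0 x, y⟫ = ⟪x, reflAt e 0 y⟫ := by
  simp only [reflAt, inner_sub_left, inner_sub_right, real_inner_smul_left,
    real_inner_smul_right, real_inner_comm e]
  ring

lemma norm_sub_reflAt_sq (he : ‖e‖ = 1) (lam : ℝ) (x y : Rd d) :
    ‖x - reflAt e lam y‖ ^ 2 = ‖x - y‖ ^ 2 + 4 * (lam - ⟪x, e⟫) * (lam - ⟪y, e⟫) := by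
  have h : x - reflAt e lam y = (x - y) + (2 * ⟪y, e⟫ - 2 * lam) • e := by
    simp only [reflAt]; abel
  rw [h, norm_add_sq_real, norm_smul, he, real_inner_smul_right, inner_sub_left, mul_one,
    Real.norm_eq_abs, sq_abs]
  ring

lemma reflAt_of_inner_eq {lam : ℝ} {x : Rd d} (hx : ⟪x, e⟫ = lam) : reflAt e lam x = x := by
  simp [reflAt, hx]

lemma continuous_reflAt : Continuous (fun p : ℝ × Rd d => reflAt e p.1 p.2) := by
  unfold reflAt; fun_prop

lemma continuous_reflAt_right (lam : ℝ) : Continuous (reflAt e lam) :=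
  continuous_reflAt.comp (Continuous.prodMk_right lam)

lemma measurePreserving_reflAt (he : ‖e‖ = 1) (lam : ℝ) :
    MeasurePreserving (reflAt e lam) (volume : Measure (Rd d)) volume := by
  rw [show reflAt e lam = (fun y => y + (2 * lam) • e) ∘ (ℝ ∙ e)ᗮ.reflection from
    funext fun x => reflAt_eq he lam x]
  exact (measurePreserving_add_right volume _).comp (LinearIsometryEquiv.measurePreserving _)

lemma measurableEmbedding_reflAt (he : ‖e‖ = 1) (lam : ℝ) :
    MeasurableEmbedding (reflAt e lam) :=
  MeasurableEquiv.measurableEmbedding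
    ⟨⟨reflAt e lam, reflAt e lam, reflAt_reflAt he lam, reflAt_reflAt he lam⟩,
      (continuous_reflAt_right lam).measurable, (continuous_reflAt_right lam).measurable⟩

lemma setIntegral_reflAt (he : ‖e‖ = 1) (lam : ℝ) (F : Rd d → ℝ) (s : Set (Rd d)) :
    ∫ x in reflAt e lam ⁻¹' s, F (reflAt e lam x) = ∫ x in s, F x :=
  (measurePreserving_reflAt he lam).setIntegral_preimage_emb (measurableEmbedding_reflAt he lam) F s

lemma norm_le_norm_reflAt (he : ‖e‖ = 1) (lam : ℝ) (x : Rd d) :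
    ‖x‖ ≤ ‖reflAt e lam x‖ + 2 * |lam| := by
  have h : reflAt e 0 x = reflAt e lam x - (2 * lam) • e := by
    simp only [reflAt]; module
  rw [← norm_reflAt_zero he x, h]
  refine (norm_sub_le _ _).trans ?_
  rw [norm_smul, he, Real.norm_eq_abs, abs_mul]
  simp

end Reflection

/-! ### Doubling of variables -/

lemma tendsto_setIntegral_ball_zero {d : ℕ} (hd : 0 < d) {F : Rd d → ℝ} {r : ℝ} {x : Rd d}
    (hF : IntegrableOn F (ball x r)) (hr : 0 < r) :
    Tendsto (fun k : ℕ => ∫ z in ball x (r * (1 / ((k : ℝ) + 1))), F z) atTop (𝓝 0) := by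
  have : NeZero d := ⟨hd.ne'⟩
  have hlim : Tendsto (fun k : ℕ => r * (1 / ((k : ℝ) + 1))) atTop (𝓝 0) := by
    simpa using tendsto_one_div_add_atTop_nhds_zero_nat.const_mul r
  have hanti : Antitone (fun k : ℕ => ball x (r * (1 / ((k : ℝ) + 1)))) := by
    intro k l hkl
    refine ball_subset_ball ?_
    gcongr
  have h := tendsto_setIntegral_of_antitone (f := F) (μ := volume)
    (fun k : ℕ => (measurableSet_ball : MeasurableSet (ball x (r * (1 / ((k : ℝ) + 1)))))) hanti
    ⟨0, by simpa using hF⟩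
  have hinter : (⋂ k : ℕ, ball x (r * (1 / ((k : ℝ) + 1)))) = {x} := by
    ext z
    simp only [mem_iInter, mem_ball, mem_singleton_iff]
    refine ⟨fun hz => ?_, fun hz k => by rw [hz, dist_self]; positivity⟩
    exact dist_le_zero.1 (ge_of_tendsto' hlim fun k => (hz k).le)
  rwa [hinter, setIntegral_measure_zero _ (measure_singleton x)] at h

namespace PsiSetting

variable {d : ℕ} (S : PsiSetting d)

lemma sub_le_of_isMin_doubling (hd : 0 < d) {Ω : Set (Rd d)} {g u : Rd d → ℝ} {M : ℝ}
    (hu : Continuous u) (hM : ∀ y, |u y| ≤ M) (hs : IsSol S Ω (fun _ => 0) g u)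
    {e : Rd d} (he : ‖e‖ = 1) {lam : ℝ} {x₀ x y : Rd d} (hx : x ∈ Ω)
    (hy : reflAt e lam y ∈ Ω) {N θ ρ r : ℝ} (hN : 0 ≤ N) (hθ : 0 ≤ θ) (hr : 0 < r)
    (hr1 : r ≤ 1) (hxρ : ‖x - x₀‖ + r ≤ ρ) (hyρ : ‖y - x₀‖ + r ≤ ρ)
    (hmin : ∀ x' y', ‖x' - x₀‖ ≤ ρ → ‖y' - x₀‖ ≤ ρ →
      u x - u (reflAt e lam y) + N * ‖x - y‖ ^ 2 + θ * ‖x - x₀‖ ^ 2 ≤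
        u x' - u (reflAt e lam y') + N * ‖x' - y'‖ ^ 2 + θ * ‖x' - x₀‖ ^ 2) :
    g x - g (reflAt e lam y) ≤ θ * (∫ z in ball (0 : Rd d) r, ‖z‖ ^ 2 * S.j ‖z‖) +
      ∫ z in (ball 0 r)ᶜ, (u x - u (reflAt e lam y) -
        (u (x + z) - u (reflAt e lam (y + z)))) * S.j ‖z‖ := by
  set R := reflAt e lam with hR
  have hRc : Continuous R := continuous_reflAt_right lam
  have hnorm : ∀ a z : Rd d, ‖z‖ ≤ r → ‖a + z - x₀‖ ≤ ‖a - x₀‖ + r := fun a z hz => by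
    rw [add_sub_right_comm]
    exact (norm_add_le _ _).trans (by linarith)
  have hexp : ∀ a z : Rd d, ‖a + z‖ ^ 2 = ‖a‖ ^ 2 + 2 * ⟪z, a⟫ + ‖z‖ ^ 2 := fun a z => by
    rw [norm_add_sq_real, real_inner_comm]
  set B : Rd d → ℝ := fun z => u x - u (R y) - (u (x + z) - u (R (y + z))) with hB
  set B' : Rd d → ℝ := fun z => B z - if ‖z‖ < r then 2 * θ * ⟪z, x - x₀⟫ else 0 with hB'
  have hBm : Measurable B := by
    have : Continuous B := by rw [hB]; fun_prop
    exact this.measurable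
  have hBb : ∀ z, |B z| ≤ M + M + (M + M) := fun z =>
    (abs_sub _ _).trans (add_le_add ((abs_sub _ _).trans (add_le_add (hM _) (hM _)))
      ((abs_sub _ _).trans (add_le_add (hM _) (hM _))))
  set l : Rd d → ℝ := fun z => if ‖z‖ < r then 2 * θ * ⟪z, x - x₀⟫ else 0 with hl
  have hlm : Measurable l :=
    Measurable.ite (measurableSet_lt measurable_norm measurable_const)
      (by fun_prop) measurable_const
  have hlb : ∀ z, |l z| ≤ 2 * θ * ‖x - x₀‖ := fun z => by
    simp only [hl]
    split_ifs with hz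
    · rw [abs_mul, abs_of_nonneg (by positivity)]
      exact mul_le_mul_of_nonneg_left ((abs_real_inner_le_norm _ _).trans
        (mul_le_of_le_one_left (norm_nonneg _) (by linarith))) (by positivity)
    · simp only [abs_zero]; positivity
  have hB'le : ∀ z, ‖z‖ < r → B' z ≤ θ * ‖z‖ ^ 2 := fun z hz => by
    have h := hmin (x + z) (y + z) ((hnorm x z hz.le).trans hxρ) ((hnorm y z hz.le).trans hyρ)
    rw [add_sub_add_right_eq_sub, add_sub_right_comm, hexp] at h
    simp only [hB', hB, if_pos hz]
    linarith
  have key : ∀ s, 0 < s → s < r → g x - g (R y) ≤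
      (2 * N + θ) * (∫ z in ball (0 : Rd d) s, ‖z‖ ^ 2 * S.j ‖z‖) +
      (θ * (∫ z in ball (0 : Rd d) r, ‖z‖ ^ 2 * S.j ‖z‖) +
        ∫ z in (ball 0 r)ᶜ, B z * S.j ‖z‖) := by
    intro s hs0 hsr
    have h1 := S.le_of_isSuperSol hd (p := -((2 * N) • (x - y) + (2 * θ) • (x - x₀)))
      (C := N + θ) hu hM hs.2 hx (by positivity) hr1 (fun z hz => by
        have h := hmin (x + z) y ((hnorm x z hz).trans hxρ) (by linarith)
        rw [add_sub_right_comm, add_sub_right_comm, hexp, hexp] at h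
        rw [inner_neg_right, inner_add_right, real_inner_smul_right, real_inner_smul_right]
        linarith) hs0 hsr
    have h2 := S.le_of_isSubSol hd (p := -((2 * N) • reflAt e 0 (x - y)))
      (C := N) hu hM hs.1 hy hN hr1 (fun z hz => by
        have hz' : ‖reflAt e 0 z‖ ≤ r := by rwa [norm_reflAt_zero he]
        have h := hmin x (y + reflAt e 0 z) (by linarith) ((hnorm y _ hz').trans hyρ)
        have e1 : R (y + reflAt e 0 z) = R y + z := by
          rw [hR, reflAt_add, reflAt_reflAt he]
        have e2 : x - (y + reflAt e 0 z) = (x - y) + -reflAt e 0 z := by abel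
        rw [e1, e2, hexp, inner_neg_left, norm_neg, norm_reflAt_zero he,
          inner_reflAt_zero_left] at h
        rw [inner_neg_right, real_inner_smul_right]
        linarith) hs0 hsr
    have h3 : ∫ z in (ball 0 s)ᶜ, (u (R y) - u (R y + z)) * S.j ‖z‖ =
        ∫ z in (ball 0 s)ᶜ, (u (R y) - u (R (y + z))) * S.j ‖z‖ := by
      rw [← setIntegral_reflAt he 0]
      congr 1
      · congr 1
        ext z
        simp [norm_reflAt_zero he]
      · funext z
        rw [norm_reflAt_zero he, hR, reflAt_add]
    have hi1 : IntegrableOn (fun z => (u x - u (x + z)) * S.j ‖z‖) (ball 0 s)ᶜ :=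
      S.integrableOn_bdd_mul_j hd hs0
        (measurable_const.sub (hu.comp (continuous_const_add x)).measurable)
        (fun z => (abs_sub _ _).trans (add_le_add (hM _) (hM _)))
    have hi2 : IntegrableOn (fun z => (u (R y) - u (R (y + z))) * S.j ‖z‖) (ball 0 s)ᶜ :=
      S.integrableOn_bdd_mul_j hd hs0
        (measurable_const.sub ((hu.comp hRc).comp (continuous_const_add y)).measurable)
        (fun z => (abs_sub _ _).trans (add_le_add (hM _) (hM _)))
    have hiB := S.integrableOn_bdd_mul_j hd hs0 hBm hBb
    have hil := S.integrableOn_bdd_mul_j hd hs0 hlm hlb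
    have h4 : (∫ z in (ball 0 s)ᶜ, (u x - u (x + z)) * S.j ‖z‖) -
        ∫ z in (ball 0 s)ᶜ, (u (R y) - u (R (y + z))) * S.j ‖z‖ =
        ∫ z in (ball 0 s)ᶜ, B' z * S.j ‖z‖ := by
      have hodd : ∫ z in (ball 0 s)ᶜ, l z * S.j ‖z‖ = 0 :=
        integral_compl_ball_eq_zero_of_odd (fun z => by
          simp only [hl, norm_neg, inner_neg_left]
          split_ifs <;> ring) s
      have hBB' : ∫ z in (ball 0 s)ᶜ, B' z * S.j ‖z‖ = ∫ z in (ball 0 s)ᶜ, B z * S.j ‖z‖ := by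
        simp only [hB', sub_mul]
        rw [integral_sub hiB hil, hodd, sub_zero]
      rw [hBB', ← integral_sub hi1 hi2]
      congr 1
      funext z
      simp only [hB]
      ring
    have hiB' : IntegrableOn (fun z => B' z * S.j ‖z‖) (ball 0 s)ᶜ := by
      refine (hiB.sub hil).congr_fun (fun z _ => ?_) measurableSet_ball.compl
      simp only [hB', hl, Pi.sub_apply]
      ring
    have hiq := S.integrableOn_sq_mul_j hd hr1
    have hsplit : (ball (0 : Rd d) s)ᶜ = (ball 0 r ∩ (ball 0 s)ᶜ) ∪ (ball 0 r)ᶜ := by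
      ext z
      simp only [mem_compl_iff, mem_ball_zero_iff, mem_union, mem_inter_iff, not_lt]
      constructor
      · intro h
        rcases lt_or_ge ‖z‖ r with h' | h'
        · exact Or.inl ⟨h', h⟩
        · exact Or.inr h'
      · rintro (h | h)
        · exact h.2
        · linarith
    have h5 : ∫ z in (ball 0 s)ᶜ, B' z * S.j ‖z‖ ≤
        θ * (∫ z in ball (0 : Rd d) r, ‖z‖ ^ 2 * S.j ‖z‖) +
          ∫ z in (ball 0 r)ᶜ, B z * S.j ‖z‖ := by
      rw [hsplit, setIntegral_union (disjoint_compl_right.mono_left inter_subset_left)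
        measurableSet_ball.compl
        (hiB'.mono_set inter_subset_right)
        (hiB'.mono_set (compl_subset_compl.2 (ball_subset_ball hsr.le)))]
      refine add_le_add ?_ (le_of_eq ?_)
      · rw [← integral_const_mul]
        calc ∫ z in ball 0 r ∩ (ball 0 s)ᶜ, B' z * S.j ‖z‖
            ≤ ∫ z in ball (0 : Rd d) r ∩ (ball 0 s)ᶜ, θ * (‖z‖ ^ 2 * S.j ‖z‖) := by
              refine setIntegral_mono_on (hiB'.mono_set inter_subset_right)
                ((hiq.mono_set inter_subset_left).const_mul θ)
                (measurableSet_ball.inter measurableSet_ball.compl) fun z hz => ?_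
              rw [← mul_assoc]
              exact mul_le_mul_of_nonneg_right (hB'le z (mem_ball_zero_iff.1 hz.1)) (S.j_nonneg _)
          _ ≤ _ := by
              refine setIntegral_mono_set (hiq.const_mul θ) (ae_of_all _ fun z => ?_)
                (ae_of_all _ inter_subset_left)
              have := S.j_nonneg ‖z‖
              simp only [Pi.zero_apply]
              positivity
      · refine setIntegral_congr_fun measurableSet_ball.compl fun z hz => ?_
        have : ¬ ‖z‖ < r := by simpa using hz
        simp only [hB', if_neg this, sub_zero]
    rw [h3] at h2
    linarith
  have hlim := (tendsto_setIntegral_ball_zero hd (S.integrableOn_sq_mul_j hd hr1)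
    hr).const_mul (2 * N + θ)
  rw [mul_zero] at hlim
  have hlim2 := hlim.add_const (θ * (∫ z in ball (0 : Rd d) r, ‖z‖ ^ 2 * S.j ‖z‖) +
        ∫ z in (ball 0 r)ᶜ, B z * S.j ‖z‖)
  rw [zero_add] at hlim2
  refine ge_of_tendsto hlim2 ?_
  filter_upwards [eventually_gt_atTop 0] with k hk
  refine key _ (by positivity) ?_
  refine mul_lt_of_lt_one_right hr ?_
  rw [div_lt_one (by positivity)]
  have : (0 : ℝ) < k := by exact_mod_cast hk
  linarith

end PsiSetting

/-! ### The equation for the difference of a solution and its reflection -/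

namespace PsiSetting

variable {d : ℕ} (S : PsiSetting d)

/-- If `u - u ∘ R` has a local minimum at `x₀`, then the difference of the two equations for `u`
may be tested at `x₀` as if `u` were smooth. -/
lemma sub_le_of_isMin_sub_reflAt (hd : 0 < d) {Ω : Set (Rd d)} (hΩ : IsOpen Ω)
    {g u : Rd d → ℝ} {M : ℝ} (hu : UniformContinuous u) (hg : Continuous g)
    (hM : ∀ y, |u y| ≤ M) (hs : IsSol S Ω (fun _ => 0) g u)
    {e : Rd d} (he : ‖e‖ = 1) {lam : ℝ} {x₀ : Rd d} (hx : x₀ ∈ Ω)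
    (hRx : reflAt e lam x₀ ∈ Ω) {ρ r : ℝ} (hr : 0 < r) (hr1 : r ≤ 1) (hrρ : r < ρ)
    (hmin : ∀ x, ‖x - x₀‖ ≤ ρ →
      u x₀ - u (reflAt e lam x₀) ≤ u x - u (reflAt e lam x)) :
    g x₀ - g (reflAt e lam x₀) ≤ ∫ z in (ball (0 : Rd d) r)ᶜ,
      (u x₀ - u (reflAt e lam x₀) - (u (x₀ + z) - u (reflAt e lam (x₀ + z)))) * S.j ‖z‖ := by
  have hρ : 0 ≤ ρ := (hr.trans hrρ).le
  have hc := hu.continuous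
  have hR := continuous_reflAt_right (e := e) lam
  have hM' := fun y => abs_le.1 (hM y)
  have key : ∀ θ > (0 : ℝ), g x₀ - g (reflAt e lam x₀) ≤
      θ * (∫ z in ball (0 : Rd d) r, ‖z‖ ^ 2 * S.j ‖z‖) + ∫ z in (ball (0 : Rd d) r)ᶜ,
        (u x₀ - u (reflAt e lam x₀) - (u (x₀ + z) - u (reflAt e lam (x₀ + z)))) * S.j ‖z‖ := by
    intro θ hθ
    have hex : ∀ n : ℕ, ∃ p : Rd d × Rd d, (‖p.1 - x₀‖ ≤ ρ ∧ ‖p.2 - x₀‖ ≤ ρ) ∧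
        ∀ x' y', ‖x' - x₀‖ ≤ ρ → ‖y' - x₀‖ ≤ ρ →
          u p.1 - u (reflAt e lam p.2) + (n : ℝ) * ‖p.1 - p.2‖ ^ 2 + θ * ‖p.1 - x₀‖ ^ 2 ≤
            u x' - u (reflAt e lam y') + (n : ℝ) * ‖x' - y'‖ ^ 2 + θ * ‖x' - x₀‖ ^ 2 := by
      intro n
      obtain ⟨p, hp, hpm⟩ := ((isCompact_closedBall x₀ ρ).prod
        (isCompact_closedBall x₀ ρ)).exists_isMinOn ⟨(x₀, x₀), by simp [hρ], by simp [hρ]⟩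
        (f := fun p : Rd d × Rd d => u p.1 - u (reflAt e lam p.2) +
          (n : ℝ) * ‖p.1 - p.2‖ ^ 2 + θ * ‖p.1 - x₀‖ ^ 2) (by fun_prop)
      exact ⟨p, ⟨by simpa [dist_eq_norm] using hp.1, by simpa [dist_eq_norm] using hp.2⟩,
        fun x' y' h1 h2 => hpm (show (x', y') ∈ _ from
          ⟨by simpa [dist_eq_norm] using h1, by simpa [dist_eq_norm] using h2⟩)⟩
    choose p hp hpm using hex
    have hbase : ∀ n : ℕ, u (p n).1 - u (reflAt e lam (p n).2) +
        (n : ℝ) * ‖(p n).1 - (p n).2‖ ^ 2 + θ * ‖(p n).1 - x₀‖ ^ 2 ≤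
          u x₀ - u (reflAt e lam x₀) := by
      intro n
      simpa using hpm n x₀ x₀ (by simpa using hρ) (by simpa using hρ)
    have hsq : ∀ a : ℕ → ℝ, (∀ n, 0 ≤ a n) → Tendsto (fun n => a n ^ 2) atTop (𝓝 0) →
        Tendsto a atTop (𝓝 0) := by
      intro a ha h
      simpa [Real.sqrt_sq (ha _)] using h.sqrt
    have hxy : Tendsto (fun n => ‖(p n).1 - (p n).2‖) atTop (𝓝 0) := by
      refine hsq _ (fun _ => norm_nonneg _) ?_
      refine squeeze_zero' (Eventually.of_forall fun _ => sq_nonneg _) ?_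
        (tendsto_const_div_atTop_nhds_zero_nat (4 * M))
      filter_upwards [eventually_gt_atTop 0] with n hn
      have hn' : (0 : ℝ) < n := by exact_mod_cast hn
      rw [le_div_iff₀ hn']
      have := hbase n
      have := mul_nonneg hθ.le (sq_nonneg ‖(p n).1 - x₀‖)
      nlinarith [hM' (p n).1, hM' (reflAt e lam (p n).2), hM' x₀, hM' (reflAt e lam x₀)]
    have hdu : Tendsto (fun n => u (p n).2 - u (p n).1) atTop (𝓝 0) := by
      rw [Metric.tendsto_atTop]
      intro ε hε
      obtain ⟨δ, hδ, h⟩ := Metric.uniformContinuous_iff.1 hu ε hε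
      obtain ⟨n₀, hn₀⟩ := Metric.tendsto_atTop.1 hxy δ hδ
      refine ⟨n₀, fun n hn => ?_⟩
      rw [dist_zero_right, ← dist_eq_norm, dist_comm]
      apply h
      simpa [dist_eq_norm] using hn₀ n hn
    have hx₁ : Tendsto (fun n => ‖(p n).1 - x₀‖) atTop (𝓝 0) := by
      refine hsq _ (fun _ => norm_nonneg _) ?_
      refine squeeze_zero (fun _ => sq_nonneg _) (fun n => ?_)
        (by simpa using hdu.div_const θ)
      rw [le_div_iff₀ hθ]
      have h1 := hbase n
      have h2 := hmin _ (hp n).2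
      have h3 : 0 ≤ (n : ℝ) * ‖(p n).1 - (p n).2‖ ^ 2 := by positivity
      linarith
    have hx₁' : Tendsto (fun n => (p n).1) atTop (𝓝 x₀) :=
      tendsto_iff_norm_sub_tendsto_zero.2 hx₁
    have hx₂' : Tendsto (fun n => (p n).2) atTop (𝓝 x₀) := by
      have := hx₁'.sub (tendsto_zero_iff_norm_tendsto_zero.2 hxy)
      simpa using this
    have hx₂ : Tendsto (fun n => ‖(p n).2 - x₀‖) atTop (𝓝 0) :=
      tendsto_iff_norm_sub_tendsto_zero.1 hx₂'
    have hRx₂ : Tendsto (fun n => reflAt e lam (p n).2) atTop (𝓝 (reflAt e lam x₀)) :=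
      (hR.tendsto _).comp hx₂'
    have hev : ∀ᶠ n in atTop, g (p n).1 - g (reflAt e lam (p n).2) ≤
        θ * (∫ z in ball (0 : Rd d) r, ‖z‖ ^ 2 * S.j ‖z‖) + ∫ z in (ball (0 : Rd d) r)ᶜ,
          (u (p n).1 - u (reflAt e lam (p n).2) -
            (u ((p n).1 + z) - u (reflAt e lam ((p n).2 + z)))) * S.j ‖z‖ := by
      filter_upwards [hx₁'.eventually (hΩ.mem_nhds hx), hRx₂.eventually (hΩ.mem_nhds hRx),
        hx₁.eventually (ge_mem_nhds (sub_pos.2 hrρ)),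
        hx₂.eventually (ge_mem_nhds (sub_pos.2 hrρ))] with n h1 h2 h3 h4
      exact S.sub_le_of_isMin_doubling hd hc hM hs he h1 h2 (Nat.cast_nonneg n) hθ.le hr hr1
        (by linarith) (by linarith) (hpm n)
    refine le_of_tendsto_of_tendsto (((hg.tendsto _).comp hx₁').sub ((hg.tendsto _).comp hRx₂))
      (Tendsto.const_add _ ?_) hev
    refine tendsto_integral_of_dominated_convergence (fun z => 4 * M * S.j ‖z‖) (fun n => ?_)
      ((S.integrableOn_j hd hr).const_mul _) (fun n => ?_) ?_
    · refine ((Continuous.measurable ?_).mul S.measurable_j_norm).aestronglyMeasurable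
      fun_prop
    · refine ae_of_all _ fun z => ?_
      rw [norm_mul, Real.norm_of_nonneg (S.j_nonneg _)]
      refine mul_le_mul_of_nonneg_right ?_ (S.j_nonneg _)
      rw [Real.norm_eq_abs, abs_le]
      constructor <;>
      linarith [hM' (p n).1, hM' (reflAt e lam (p n).2), hM' ((p n).1 + z),
        hM' (reflAt e lam ((p n).2 + z))]
    · refine ae_of_all _ fun z => Tendsto.mul_const _ ?_
      refine (((hc.tendsto _).comp hx₁').sub ((hc.tendsto _).comp hRx₂)).sub
        (((hc.tendsto _).comp (hx₁'.add_const z)).sub ((hc.tendsto _).comp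
          ((hR.tendsto _).comp (hx₂'.add_const z))))
  have hlim : Tendsto (fun θ : ℝ => θ * (∫ z in ball (0 : Rd d) r, ‖z‖ ^ 2 * S.j ‖z‖) +
      ∫ z in (ball (0 : Rd d) r)ᶜ, (u x₀ - u (reflAt e lam x₀) -
        (u (x₀ + z) - u (reflAt e lam (x₀ + z)))) * S.j ‖z‖) (𝓝[>] 0)
      (𝓝 (0 * (∫ z in ball (0 : Rd d) r, ‖z‖ ^ 2 * S.j ‖z‖) +
        ∫ z in (ball (0 : Rd d) r)ᶜ, (u x₀ - u (reflAt e lam x₀) -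
          (u (x₀ + z) - u (reflAt e lam (x₀ + z)))) * S.j ‖z‖)) :=
    (tendsto_nhdsWithin_of_tendsto_nhds tendsto_id).mul_const _ |>.add_const _
  rw [zero_mul, zero_add] at hlim
  exact ge_of_tendsto hlim (eventually_mem_nhdsWithin.mono key)

end PsiSetting

/-! ### Folding onto a half-space -/

section HalfSpace

variable {d : ℕ} {e : Rd d}

lemma measurableSet_halfSpace (lam : ℝ) : MeasurableSet (halfSpace e lam) :=
  (isOpen_lt continuous_const (by fun_prop)).measurableSet

lemma isOpen_inner_lt (lam : ℝ) : IsOpen {y : Rd d | ⟪y, e⟫ < lam} :=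
  isOpen_lt (by fun_prop) continuous_const

lemma reflAt_preimage_inner_lt (he : ‖e‖ = 1) (lam : ℝ) :
    reflAt e lam ⁻¹' {y | ⟪y, e⟫ < lam} = halfSpace e lam := by
  ext y
  simp only [mem_preimage, mem_ofPred_eq, inner_reflAt he, halfSpace]
  constructor <;> intro h <;> linarith

lemma reflAt_preimage_halfSpace (he : ‖e‖ = 1) (lam : ℝ) :
    reflAt e lam ⁻¹' halfSpace e lam = {y | ⟪y, e⟫ < lam} := by
  ext y
  simp only [mem_preimage, mem_ofPred_eq, inner_reflAt he, halfSpace]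
  constructor <;> intro h <;> linarith

lemma volume_inner_eq (he : ‖e‖ = 1) (lam : ℝ) :
    volume {y : Rd d | ⟪y, e⟫ = lam} = 0 := by
  have h : {y : Rd d | ⟪y, e⟫ = lam} = AffineSubspace.mk' (lam • e) (ℝ ∙ e)ᗮ := by
    ext y
    simp only [mem_ofPred_eq, SetLike.mem_coe, AffineSubspace.mem_mk', vsub_eq_sub,
      Submodule.mem_orthogonal_singleton_iff_inner_left, inner_sub_left, real_inner_smul_left,
      real_inner_self_eq_norm_sq, he]
    constructor <;> intro h <;> linarith
  rw [h]
  refine Measure.addHaar_affineSubspace _ _ fun htop => ?_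
  have hmem : (lam + 1) • e ∈ AffineSubspace.mk' (lam • e) (ℝ ∙ e)ᗮ := htop ▸ trivial
  rw [← SetLike.mem_coe, ← h] at hmem
  simp [real_inner_smul_left, he] at hmem

lemma compl_inner_lt_ae_eq (he : ‖e‖ = 1) (lam : ℝ) :
    ({y : Rd d | ⟪y, e⟫ < lam}ᶜ : Set (Rd d)) =ᵐ[volume] halfSpace e lam := by
  have h : ∀ᵐ y : Rd d, ⟪y, e⟫ ≠ lam := measure_eq_zero_iff_ae_notMem.1 (volume_inner_eq he lam)
  filter_upwards [h] with y hy
  refine propext ?_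
  change ¬ ⟪y, e⟫ < lam ↔ lam < ⟪y, e⟫
  rw [not_lt]
  exact ⟨fun h => lt_of_le_of_ne h hy.symm, le_of_lt⟩

lemma halfSpace_subset_compl_ball (he : ‖e‖ = 1) (δ : ℝ) :
    halfSpace e δ ⊆ (ball (0 : Rd d) δ)ᶜ := by
  intro z hz
  have h := real_inner_le_norm z e
  rw [he, mul_one] at h
  simpa using (lt_of_lt_of_le hz h).le

end HalfSpace

namespace PsiSetting

variable {d : ℕ} (S : PsiSetting d) {e : Rd d}

lemma integrableOn_j_halfSpace (hd : 0 < d) (he : ‖e‖ = 1) {δ : ℝ} (hδ : 0 < δ) :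
    IntegrableOn (fun z => S.j ‖z‖) (halfSpace e δ) :=
  (S.integrableOn_j hd hδ).mono_set (halfSpace_subset_compl_ball he δ)

lemma setIntegral_j_halfSpace_pos (hd : 0 < d) (he : ‖e‖ = 1) {δ : ℝ} (hδ : 0 < δ) :
    0 < ∫ z in halfSpace e δ, S.j ‖z‖ := by
  rw [setIntegral_pos_iff_support_of_nonneg_ae (ae_of_all _ fun _ => S.j_nonneg _)
    (S.integrableOn_j_halfSpace hd he hδ)]
  have hsub : halfSpace e δ ⊆ Function.support (fun z : Rd d => S.j ‖z‖) := fun z hz => by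
    have := halfSpace_subset_compl_ball he δ hz
    refine (S.j_pos hd (hδ.trans_le ?_)).ne'
    simpa using this
  rw [inter_eq_self_of_subset_right hsub]
  refine (isOpen_lt continuous_const (by fun_prop)).measure_pos _ ⟨(δ + 1) • e, ?_⟩
  simp [real_inner_smul_left, he]

lemma setIntegral_j_halfSpace_anti (hd : 0 < d) (he : ‖e‖ = 1) {δ δ' : ℝ} (hδ : 0 < δ)
    (hδ' : δ ≤ δ') : ∫ z in halfSpace e δ', S.j ‖z‖ ≤ ∫ z in halfSpace e δ, S.j ‖z‖ :=
  setIntegral_mono_set (S.integrableOn_j_halfSpace hd he hδ)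
    (ae_of_all _ fun _ => S.j_nonneg _)
    (LE.le.eventuallyLE fun _ hz => lt_of_le_of_lt hδ' hz)

lemma lintegral_j_halfSpace_zero (hd : 0 < d) (he : ‖e‖ = 1) :
    ∫⁻ z in halfSpace e 0, ENNReal.ofReal (S.j ‖z‖) = ∞ := by
  have h := S.lintegral_j hd
  have hm : MeasurableSet (halfSpace e 0)ᶜ := (measurableSet_halfSpace 0).compl
  rw [← lintegral_add_compl _ (isOpen_inner_lt (e := e) 0).measurableSet,
    setLIntegral_congr (compl_inner_lt_ae_eq he 0)] at h
  have h2 : ∫⁻ z in {y : Rd d | ⟪y, e⟫ < 0}, ENNReal.ofReal (S.j ‖z‖) =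
      ∫⁻ z in halfSpace e 0, ENNReal.ofReal (S.j ‖z‖) := by
    rw [← (measurePreserving_reflAt he 0).setLIntegral_comp_preimage_emb
      (measurableEmbedding_reflAt he 0), reflAt_preimage_inner_lt he]
    simp only [norm_reflAt_zero he]
  rw [h2] at h
  simpa using h

/-- The kernel has infinite mass near the boundary of a half-space through the origin. -/
lemma exists_lt_setIntegral_j_halfSpace (hd : 0 < d) (he : ‖e‖ = 1) (C : ℝ) :
    ∃ δ > 0, C < ∫ z in halfSpace e δ, S.j ‖z‖ := by
  by_contra! hcon
  have hU : halfSpace e 0 = ⋃ k : ℕ, halfSpace e (1 / ((k : ℝ) + 1)) := by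
    ext z
    simp only [halfSpace, mem_iUnion, mem_ofPred_eq]
    exact ⟨exists_nat_one_div_lt, fun ⟨k, hk⟩ => lt_trans (by positivity) hk⟩
  have h := S.lintegral_j_halfSpace_zero hd he
  rw [hU, setLIntegral_iUnion_of_directed] at h
  · have hle : ⨆ k : ℕ, ∫⁻ z in halfSpace e (1 / ((k : ℝ) + 1)), ENNReal.ofReal (S.j ‖z‖) ≤
        ENNReal.ofReal C := by
      refine iSup_le fun k => ?_
      have hk : (0 : ℝ) < 1 / ((k : ℝ) + 1) := by positivity
      rw [← ofReal_integral_eq_lintegral_ofReal (S.integrableOn_j_halfSpace hd he hk)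
        (ae_of_all _ fun _ => S.j_nonneg _)]
      exact ENNReal.ofReal_le_ofReal (hcon _ hk)
    rw [h] at hle
    simp at hle
  · have hmono : Monotone fun k : ℕ => halfSpace e (1 / ((k : ℝ) + 1)) := by
      intro k l hkl z hz
      have hkl' : 1 / ((l : ℝ) + 1) ≤ 1 / ((k : ℝ) + 1) := by gcongr
      exact lt_of_le_of_lt hkl' hz
    exact hmono.directed_le

lemma integrableOn_bdd_mul_j_sub (hd : 0 < d) {r K : ℝ} (hr : 0 < r) {F : Rd d → ℝ}
    (hF : Measurable F) (hK : ∀ z, |F z| ≤ K) (x : Rd d) :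
    IntegrableOn (fun y => F y * S.j ‖y - x‖) (ball x r)ᶜ := by
  have h := S.integrableOn_bdd_mul_j hd hr (F := fun z => F (z + x))
    (hF.comp (measurable_add_const x)) (fun z => hK _)
  rw [← (measurePreserving_sub_right volume x).integrableOn_comp_preimage
    (MeasurableEquiv.subRight x).measurableEmbedding] at h
  have hpre : (fun y => y - x) ⁻¹' (ball (0 : Rd d) r)ᶜ = (ball x r)ᶜ := by
    ext y; simp [dist_eq_norm]
  rw [hpre] at h
  simpa [Function.comp_def] using h

lemma integrableOn_bdd_mul_j_reflAt (hd : 0 < d) (he : ‖e‖ = 1) {lam K : ℝ} {F : Rd d → ℝ}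
    (hF : Measurable F) (hK : ∀ z, |F z| ≤ K) {x : Rd d} (hx : ⟪x, e⟫ < lam) :
    IntegrableOn (fun y => F y * S.j ‖reflAt e lam y - x‖) {y | ⟪y, e⟫ < lam} := by
  have h := S.integrableOn_bdd_mul_j_sub hd (sub_pos.2 hx)
    (hF.comp (continuous_reflAt_right (e := e) lam).measurable) (fun z => hK _) x
  have hsub : halfSpace e lam ⊆ (ball x (lam - ⟪x, e⟫))ᶜ := fun y hy => by
    have h := real_inner_le_norm (y - x) e
    have hy' : lam < ⟪y, e⟫ := hy
    rw [he, mul_one, inner_sub_left] at h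
    simp only [mem_compl_iff, mem_ball, dist_eq_norm, not_lt]
    linarith
  have h' := h.mono_set hsub
  rw [← (measurePreserving_reflAt he lam).integrableOn_comp_preimage
    (measurableEmbedding_reflAt he lam), reflAt_preimage_halfSpace he] at h'
  simpa [Function.comp_def, reflAt_reflAt he] using h'

lemma setIntegral_j_reflAt (he : ‖e‖ = 1) (lam : ℝ) (x : Rd d) :
    ∫ y in {y | ⟪y, e⟫ < lam}, S.j ‖reflAt e lam y - x‖ =
      ∫ z in halfSpace e (lam - ⟪x, e⟫), S.j ‖z‖ := by
  rw [← reflAt_preimage_halfSpace he, setIntegral_reflAt he lam (fun y => S.j ‖y - x‖),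
    ← (measurePreserving_sub_right volume x).setIntegral_preimage_emb
      (MeasurableEquiv.subRight x).measurableEmbedding (fun z => S.j ‖z‖)]
  congr 2
  ext y
  simp [halfSpace, inner_sub_left]

/-- Folding the nonlocal difference of an antisymmetric function onto a half-space. -/
lemma setIntegral_antisymm (hd : 0 < d) (he : ‖e‖ = 1) {lam K r : ℝ} {v : Rd d → ℝ}
    (hv : Measurable v) (hK : ∀ y, |v y| ≤ K) (hanti : ∀ y, v (reflAt e lam y) = - v y)
    {x : Rd d} (hr : 0 < r) (hxr : r < lam - ⟪x, e⟫) :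
    ∫ z in (ball (0 : Rd d) r)ᶜ, (v x - v (x + z)) * S.j ‖z‖ =
      (∫ y in {y | ⟪y, e⟫ < lam} \ ball x r, (v x - v y) * S.j ‖y - x‖) +
      ∫ y in {y | ⟪y, e⟫ < lam}, (v x + v y) * S.j ‖reflAt e lam y - x‖ := by
  have hball : ball x r ⊆ {y | ⟪y, e⟫ < lam} := fun y hy => by
    have h := real_inner_le_norm (y - x) e
    rw [he, mul_one, inner_sub_left] at h
    rw [mem_ball, dist_eq_norm] at hy
    simp only [mem_ofPred_eq]
    linarith
  have hH := (isOpen_inner_lt (e := e) lam).measurableSet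
  have hpre : (fun y => y - x) ⁻¹' (ball (0 : Rd d) r)ᶜ = (ball x r)ᶜ := by
    ext y; simp [dist_eq_norm]
  have h1 : ∫ z in (ball (0 : Rd d) r)ᶜ, (v x - v (x + z)) * S.j ‖z‖ =
      ∫ y in (ball x r)ᶜ, (v x - v y) * S.j ‖y - x‖ := by
    rw [← (measurePreserving_sub_right volume x).setIntegral_preimage_emb
      (MeasurableEquiv.subRight x).measurableEmbedding, hpre]
    simp
  have hint : IntegrableOn (fun y => (v x - v y) * S.j ‖y - x‖) (ball x r)ᶜ :=
    S.integrableOn_bdd_mul_j_sub hd hr (K := K + K) (hv.const_sub _)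
      (fun y => (abs_sub _ _).trans (add_le_add (hK _) (hK _))) x
  have hU : (ball x r)ᶜ = ({y | ⟪y, e⟫ < lam} \ ball x r) ∪ {y | ⟪y, e⟫ < lam}ᶜ := by
    ext y
    have := @hball y
    simp only [mem_compl_iff, mem_union, Set.mem_sdiff]
    tauto
  rw [h1, hU, setIntegral_union (disjoint_compl_right.mono_left sdiff_subset) hH.compl
    (hint.mono_set (sdiff_subset_compl _ _)) (hint.mono_set (compl_subset_compl.2 hball)),
    setIntegral_congr_set (compl_inner_lt_ae_eq he lam), ← reflAt_preimage_inner_lt he,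
    ← setIntegral_reflAt he lam (fun y => (v x + v y) * S.j ‖reflAt e lam y - x‖)]
  simp only [hanti, reflAt_reflAt he, sub_eq_add_neg]

end PsiSetting

/-! ### Maximum principles for antisymmetric differences -/

lemma inner_le_add_norm_sub {d : ℕ} {e : Rd d} (he : ‖e‖ = 1) (x y : Rd d) :
    ⟪y, e⟫ ≤ ⟪x, e⟫ + ‖y - x‖ := by
  have h := real_inner_le_norm (y - x) e
  rw [he, mul_one, inner_sub_left] at h
  linarith

lemma norm_sub_lt_norm_reflAt_sub {d : ℕ} {e : Rd d} (he : ‖e‖ = 1) {lam : ℝ} {x y : Rd d}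
    (hx : ⟪x, e⟫ < lam) (hy : ⟪y, e⟫ < lam) : ‖y - x‖ < ‖reflAt e lam y - x‖ := by
  rw [norm_sub_rev y, norm_sub_rev _ x]
  refine lt_of_pow_lt_pow_left₀ 2 (norm_nonneg _) ?_
  rw [norm_sub_reflAt_sq he]
  nlinarith [mul_pos (sub_pos.2 hx) (sub_pos.2 hy)]

namespace PsiSetting

variable {d : ℕ} (S : PsiSetting d)

/-- The equation at a negative minimum over the half-space of `u - u ∘ R`. -/
lemma sub_le_mul_of_isMin_neg (hd : 0 < d) {Ω : Set (Rd d)} (hΩ : IsOpen Ω)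
    {g u : Rd d → ℝ} {M : ℝ} (hu : UniformContinuous u) (hg : Continuous g)
    (hM : ∀ y, |u y| ≤ M) (hs : IsSol S Ω (fun _ => 0) g u)
    {e : Rd d} (he : ‖e‖ = 1) {lam : ℝ} {x : Rd d} (hx : x ∈ Ω)
    (hRx : reflAt e lam x ∈ Ω) (hxl : ⟪x, e⟫ < lam) (hneg : u x - u (reflAt e lam x) < 0)
    (hmin : ∀ y, ⟪y, e⟫ < lam → u x - u (reflAt e lam x) ≤ u y - u (reflAt e lam y)) :
    g x - g (reflAt e lam x) ≤
      (u x - u (reflAt e lam x)) * ∫ z in halfSpace e (lam - ⟪x, e⟫), S.j ‖z‖ := by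
  have hvc : Continuous fun y => u y - u (reflAt e lam y) :=
    hu.continuous.sub (hu.continuous.comp (continuous_reflAt_right lam))
  obtain ⟨v, hv⟩ : ∃ v : Rd d → ℝ, v = fun y => u y - u (reflAt e lam y) := ⟨_, rfl⟩
  have hv' : ∀ y, u y - u (reflAt e lam y) = v y := fun y => by rw [hv]
  rw [← hv] at hvc
  simp only [hv'] at hneg hmin ⊢
  have hanti : ∀ y, v (reflAt e lam y) = - v y := fun y => by
    simp only [hv, reflAt_reflAt he, neg_sub]
  have hK : ∀ y, |v y| ≤ M + M := fun y => by
    rw [hv]; exact (abs_sub _ _).trans (add_le_add (hM _) (hM _))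
  have hδ : 0 < lam - ⟪x, e⟫ := sub_pos.2 hxl
  obtain ⟨ε, hε, hball⟩ := Metric.eventually_nhds_iff_ball.1
    (hvc.tendsto x |>.eventually (gt_mem_nhds hneg))
  obtain ⟨r, hr, hr1, hrε, hrδ⟩ : ∃ r > 0, r ≤ 1 ∧ r ≤ ε ∧ r < (lam - ⟪x, e⟫) / 2 :=
    ⟨min (min 1 ε) ((lam - ⟪x, e⟫) / 4), by positivity, (min_le_left _ _).trans (min_le_left _ _),
      (min_le_left _ _).trans (min_le_right _ _), (min_le_right _ _).trans_lt (by linarith)⟩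
  have h1 := S.sub_le_of_isMin_sub_reflAt hd hΩ hu hg hM hs he hx hRx hr hr1 hrδ fun y hy => by
    rw [hv', hv']
    exact hmin y (by linarith [inner_le_add_norm_sub he x y])
  simp only [hv'] at h1
  rw [S.setIntegral_antisymm hd he hvc.measurable hK hanti hr (by linarith)] at h1
  refine h1.trans ?_
  have hH := (isOpen_inner_lt (e := e) lam).measurableSet
  have hi1 : IntegrableOn (fun y => (v x - v y) * S.j ‖y - x‖)
      ({y | ⟪y, e⟫ < lam} \ ball x r) :=
    (S.integrableOn_bdd_mul_j_sub hd hr (K := M + M + (M + M)) (hvc.measurable.const_sub _)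
      (fun y => (abs_sub _ _).trans (add_le_add (hK _) (hK _))) x).mono_set
      (sdiff_subset_compl _ _)
  have hi2 : IntegrableOn (fun y => (v x + v y) * S.j ‖reflAt e lam y - x‖)
      {y | ⟪y, e⟫ < lam} :=
    S.integrableOn_bdd_mul_j_reflAt hd he (K := M + M + (M + M)) (hvc.measurable.const_add _)
      (fun y => (abs_add_le _ _).trans (add_le_add (hK _) (hK _))) hxl
  have hi3 : IntegrableOn (fun y => v x * S.j ‖reflAt e lam y - x‖) {y | ⟪y, e⟫ < lam} :=
    S.integrableOn_bdd_mul_j_reflAt hd he (F := fun _ => v x) measurable_const (fun _ => hK x) hxl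
  rw [← S.setIntegral_j_reflAt he, ← integral_const_mul, sdiff_eq,
    ← setIntegral_indicator measurableSet_ball.compl]
  rw [sdiff_eq] at hi1
  have hi1' := (integrable_indicator_iff measurableSet_ball.compl).2
    (show Integrable _ ((volume.restrict {y : Rd d | ⟪y, e⟫ < lam}).restrict (ball x r)ᶜ) by
      rw [Measure.restrict_restrict measurableSet_ball.compl, inter_comm]
      exact hi1)
  rw [← integral_add hi1' hi2]
  refine setIntegral_mono_on (hi1'.add hi2) hi3 hH fun y hy => ?_
  have hlt := norm_sub_lt_norm_reflAt_sub he hxl hy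
  have hj := S.j_nonneg ‖reflAt e lam y - x‖
  by_cases hyb : y ∈ ball x r
  · rw [indicator_of_notMem (by simpa using hyb), zero_add]
    have := hball y (ball_subset_ball hrε hyb)
    nlinarith
  · rw [indicator_of_mem hyb]
    have hpos : 0 < ‖y - x‖ := by
      rw [mem_ball, dist_eq_norm, not_lt] at hyb
      linarith
    have := S.j_anti hd hpos hlt.le
    have := hmin y hy
    nlinarith

/-- Strong maximum principle for `u - u ∘ R` on the half-space. -/
lemma eq_reflAt_of_isMin_zero (hd : 0 < d) {Ω : Set (Rd d)} (hΩ : IsOpen Ω)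
    {g u : Rd d → ℝ} {M : ℝ} (hu : UniformContinuous u) (hg : Continuous g)
    (hM : ∀ y, |u y| ≤ M) (hs : IsSol S Ω (fun _ => 0) g u)
    {e : Rd d} (he : ‖e‖ = 1) {lam : ℝ} {x : Rd d} (hx : x ∈ Ω)
    (hRx : reflAt e lam x ∈ Ω) (hxl : ⟪x, e⟫ < lam) (hzero : u x = u (reflAt e lam x))
    (hgx : g x = g (reflAt e lam x))
    (hmin : ∀ y, ⟪y, e⟫ < lam → 0 ≤ u y - u (reflAt e lam y)) (y : Rd d) :
    u y = u (reflAt e lam y) := by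
  have hvc : Continuous fun y => u y - u (reflAt e lam y) :=
    hu.continuous.sub (hu.continuous.comp (continuous_reflAt_right lam))
  obtain ⟨v, hv⟩ : ∃ v : Rd d → ℝ, v = fun y => u y - u (reflAt e lam y) := ⟨_, rfl⟩
  have hv' : ∀ y, u y - u (reflAt e lam y) = v y := fun y => by rw [hv]
  rw [← hv] at hvc
  simp only [hv'] at hmin
  have hvx : v x = 0 := by rw [hv]; exact sub_eq_zero.2 hzero
  have hanti : ∀ y, v (reflAt e lam y) = - v y := fun y => by
    simp only [hv, reflAt_reflAt he, neg_sub]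
  have hK : ∀ y, |v y| ≤ M + M := fun y => by
    rw [hv]; exact (abs_sub _ _).trans (add_le_add (hM _) (hM _))
  have hδ : 0 < lam - ⟪x, e⟫ := sub_pos.2 hxl
  have hH := (isOpen_inner_lt (e := e) lam).measurableSet
  have hi2 : IntegrableOn (fun y => v y * S.j ‖reflAt e lam y - x‖) {y | ⟪y, e⟫ < lam} :=
    S.integrableOn_bdd_mul_j_reflAt hd he hvc.measurable hK hxl
  have key : ∀ y, ⟪y, e⟫ < lam → v y = 0 := by
    intro y₀ hy₀
    by_contra hne
    have hvy : 0 < v y₀ := lt_of_le_of_ne (hmin y₀ hy₀) (Ne.symm hne)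
    have hyx : 0 < ‖y₀ - x‖ := norm_pos_iff.2 (sub_ne_zero.2 fun h => by simp [h, hvx] at hvy)
    obtain ⟨r₀, hr₀, hr1, hry, hrδ⟩ :
        ∃ r > 0, r ≤ 1 ∧ r < ‖y₀ - x‖ ∧ r < (lam - ⟪x, e⟫) / 2 :=
      ⟨min (min 1 (‖y₀ - x‖ / 2)) ((lam - ⟪x, e⟫) / 4), by positivity,
        (min_le_left _ _).trans (min_le_left _ _),
        ((min_le_left _ _).trans (min_le_right _ _)).trans_lt (by linarith),
        (min_le_right _ _).trans_lt (by linarith)⟩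
    have hbH : ∀ r ≤ r₀, ball x r ⊆ {y | ⟪y, e⟫ < lam} := fun r hr y hy => by
      rw [mem_ball, dist_eq_norm] at hy
      change ⟪y, e⟫ < lam
      linarith [inner_le_add_norm_sub he x y]
    have hi1 : ∀ r > 0, IntegrableOn (fun y => v y * S.j ‖y - x‖)
        ({y | ⟪y, e⟫ < lam} \ ball x r) := fun r hr =>
      (S.integrableOn_bdd_mul_j_sub hd hr hvc.measurable hK x).mono_set (sdiff_subset_compl _ _)
    have hI : ∀ r > 0, IntegrableOn (fun y => v y * (S.j ‖y - x‖ - S.j ‖reflAt e lam y - x‖))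
        ({y | ⟪y, e⟫ < lam} \ ball x r) := fun r hr => by
      simp only [mul_sub]
      exact (hi1 r hr).sub (hi2.mono_set sdiff_subset)
    have hnn : ∀ r > 0, ∀ y ∈ {y | ⟪y, e⟫ < lam} \ ball x r,
        0 ≤ v y * (S.j ‖y - x‖ - S.j ‖reflAt e lam y - x‖) := fun r hr y hy => by
      have hyb := hy.2
      rw [mem_ball, dist_eq_norm, not_lt] at hyb
      exact mul_nonneg (hmin y hy.1) (sub_nonneg.2 (S.j_anti hd (hr.trans_le hyb)
        (norm_sub_lt_norm_reflAt_sub he hxl hy.1).le))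
    have hle : ∀ r > 0, r ≤ r₀ → ∫ y in {y | ⟪y, e⟫ < lam} \ ball x r₀,
        v y * (S.j ‖y - x‖ - S.j ‖reflAt e lam y - x‖) ≤
          ∫ y in ball x r, v y * S.j ‖reflAt e lam y - x‖ := by
      intro r hr hrr
      have h1 := S.sub_le_of_isMin_sub_reflAt hd hΩ hu hg hM hs he hx hRx hr (hrr.trans hr1)
        (hrr.trans_lt hrδ) fun y hy => by
          rw [hv', hv', hvx]
          exact hmin y (by linarith [inner_le_add_norm_sub he x y])
      simp only [hv'] at h1
      rw [S.setIntegral_antisymm hd he hvc.measurable hK hanti hr (by linarith), hgx, sub_self,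
        hvx] at h1
      simp only [zero_sub, zero_add, neg_mul] at h1
      rw [integral_neg, ← sdiff_union_of_subset (hbH r hrr), setIntegral_union disjoint_sdiff_left
        measurableSet_ball (hi2.mono_set sdiff_subset) (hi2.mono_set (hbH r hrr)),
        union_sdiff_right, sdiff_idem] at h1
      have h2 : ∫ y in {y | ⟪y, e⟫ < lam} \ ball x r,
          v y * (S.j ‖y - x‖ - S.j ‖reflAt e lam y - x‖) =
          (∫ y in {y | ⟪y, e⟫ < lam} \ ball x r, v y * S.j ‖y - x‖) -
            ∫ y in {y | ⟪y, e⟫ < lam} \ ball x r, v y * S.j ‖reflAt e lam y - x‖ := by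
        simp only [mul_sub]
        exact integral_sub (hi1 r hr) (hi2.mono_set sdiff_subset)
      have h3 : ∫ y in {y | ⟪y, e⟫ < lam} \ ball x r₀,
          v y * (S.j ‖y - x‖ - S.j ‖reflAt e lam y - x‖) ≤
          ∫ y in {y | ⟪y, e⟫ < lam} \ ball x r,
            v y * (S.j ‖y - x‖ - S.j ‖reflAt e lam y - x‖) :=
        setIntegral_mono_set (hI r hr)
          ((ae_restrict_iff' (hH.diff measurableSet_ball)).2 (ae_of_all _ (hnn r hr)))
          (LE.le.eventuallyLE (sdiff_subset_sdiff_right (ball_subset_ball hrr)))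
      linarith
    have hlim := tendsto_setIntegral_ball_zero hd (hi2.mono_set (hbH r₀ le_rfl)) hr₀
    have hle0 := ge_of_tendsto' hlim fun k => hle (r₀ * (1 / ((k : ℝ) + 1))) (by positivity)
      (mul_le_of_le_one_right hr₀.le (by
        rw [div_le_one (by positivity)]; linarith [Nat.cast_nonneg (α := ℝ) k]))
    refine hle0.not_gt ?_
    rw [setIntegral_pos_iff_support_of_nonneg_ae
      ((ae_restrict_iff' (hH.diff measurableSet_ball)).2 (ae_of_all _ (hnn r₀ hr₀))) (hI r₀ hr₀)]
    have hO : IsOpen {y : Rd d | ⟪y, e⟫ < lam ∧ r₀ < ‖y - x‖ ∧ 0 < v y} :=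
      (isOpen_inner_lt lam).inter ((isOpen_lt (f := fun _ => r₀) (g := fun y => ‖y - x‖)
        continuous_const (by fun_prop)).inter (isOpen_lt continuous_const hvc))
    refine (hO.measure_pos volume ⟨y₀, hy₀, hry, hvy⟩).trans_le (measure_mono ?_)
    rintro y ⟨h1, h2, h3⟩
    refine ⟨(mul_pos h3 (sub_pos.2 (S.j_strictAnti hd (hr₀.trans h2)
      (norm_sub_lt_norm_reflAt_sub he hxl h1)))).ne', h1, ?_⟩
    rw [mem_ball, dist_eq_norm, not_lt]
    exact h2.le
  rw [← sub_eq_zero, hv']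
  rcases lt_trichotomy ⟪y, e⟫ lam with h | h | h
  · exact key y h
  · rw [← hv', reflAt_of_inner_eq h, sub_self]
  · have := key (reflAt e lam y) (by rw [inner_reflAt he]; linarith)
    rwa [hanti, neg_eq_zero] at this

end PsiSetting

/-! ### Geometry of the obstacle -/

section Geometry

variable {d : ℕ} {e : Rd d} {G : Set (Rd d)}

lemma hasC2BoundaryClosed_iUnion {ι : Type*} [Finite ι] {G : ι → Set (Rd d)}
    (hc : ∀ k, IsClosed (G k)) (hC2 : ∀ k, HasC2BoundaryClosed (G k))
    (hdisj : ∀ k l, k ≠ l → Disjoint (G k) (G l)) : HasC2BoundaryClosed (⋃ k, G k) := by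
  intro x hx
  have hcl : IsClosed (⋃ k, G k) := isClosed_iUnion_of_finite hc
  obtain ⟨k, hk⟩ := mem_iUnion.1 (hcl.frontier_subset hx)
  have hxk : x ∈ frontier (G k) :=
    ⟨subset_closure hk, fun h => hx.2 (interior_mono (subset_iUnion G k) h)⟩
  obtain ⟨U, f, hU, hxU, hf, hf', hGU⟩ := hC2 k x hxk
  have hW : IsOpen (⋃ l : {l // l ≠ k}, G l)ᶜ :=
    (isClosed_iUnion_of_finite fun l : {l // l ≠ k} => hc l).isOpen_compl
  refine ⟨U ∩ (⋃ l : {l // l ≠ k}, G l)ᶜ, f, hU.inter hW, ⟨hxU, ?_⟩, hf.mono inter_subset_left,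
    fun y hy => hf' y hy.1, ?_⟩
  · rw [mem_compl_iff, mem_iUnion]
    rintro ⟨⟨l, hl⟩, hxl⟩
    exact disjoint_left.1 (hdisj l k hl) hxl hk
  · ext y
    have hy := Set.ext_iff.1 hGU y
    simp only [mem_inter_iff, mem_ofPred_eq] at hy
    simp only [mem_inter_iff, mem_ofPred_eq, mem_compl_iff]
    constructor
    · rintro ⟨hyG, hyU, hyW⟩
      obtain ⟨l, hl⟩ := mem_iUnion.1 hyG
      have hlk : l = k := by
        by_contra hne
        exact hyW (mem_iUnion.2 ⟨⟨l, hne⟩, hl⟩)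
      subst hlk
      exact ⟨⟨hyU, hyW⟩, (hy.1 ⟨hl, hyU⟩).2⟩
    · rintro ⟨⟨hyU, hyW⟩, hfy⟩
      exact ⟨mem_iUnion.2 ⟨k, (hy.2 ⟨hyU, hfy⟩).1⟩, hyU, hyW⟩

lemma sit1_of_mem_frontier (he : ‖e‖ = 1) {lam : ℝ}
    (hrefl : ∀ x, ⟪x, e⟫ ≤ lam → reflAt e lam x ∈ G → x ∈ G) {x : Rd d}
    (hx : x ∈ frontier G) (hRx : reflAt e lam x ∈ G) (hxl : ⟪x, e⟫ < lam) : Sit1 G e lam := by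
  refine ⟨x, hx, ⟨subset_closure ⟨reflAt e lam x, ⟨hRx, ?_⟩, reflAt_reflAt he lam x⟩,
    fun h => hx.2 (interior_mono ?_ h)⟩, hxl.ne⟩
  · change lam < ⟪reflAt e lam x, e⟫
    rw [inner_reflAt he]
    linarith
  · rintro _ ⟨y, ⟨hy, hyl : lam < ⟪y, e⟫⟩, rfl⟩
    refine hrefl _ ?_ (by rwa [reflAt_reflAt he])
    rw [inner_reflAt he]
    linarith

/-- Away from the critical positions, the reflected obstacle stays inside the obstacle when the
hyperplane is moved slightly. -/
lemma eventually_reflAt_notMem (hG : IsCompact G) (hC2 : HasC2BoundaryClosed G) (he : ‖e‖ = 1)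
    {lam : ℝ} (h1 : ¬ Sit1 G e lam) (h2 : ¬ Sit2 G e lam)
    (hrefl : ∀ x, ⟪x, e⟫ ≤ lam → reflAt e lam x ∈ G → x ∈ G) :
    ∀ᶠ μ in 𝓝 lam, ∀ x, ⟪x, e⟫ < μ → x ∉ G → reflAt e μ x ∉ G := by
  by_contra hcon
  rw [not_eventually] at hcon
  obtain ⟨μ, hμ, hμx⟩ := exists_seq_forall_of_frequently hcon
  push Not at hμx
  choose x hxμ hxG hRG using hμx
  obtain ⟨y, hy, φ, hφ, hlim⟩ := hG.tendsto_subseq hRG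
  have hμφ : Tendsto (fun n => μ (φ n)) atTop (𝓝 lam) := hμ.comp hφ.tendsto_atTop
  have hlimx : Tendsto (fun n => x (φ n)) atTop (𝓝 (reflAt e lam y)) := by
    have h := (continuous_reflAt (e := e).tendsto (lam, y)).comp (hμφ.prodMk_nhds hlim)
    simpa [Function.comp_def, reflAt_reflAt he] using h
  have hxl : ⟪reflAt e lam y, e⟫ ≤ lam :=
    le_of_tendsto_of_tendsto' (hlimx.inner tendsto_const_nhds) hμφ fun n => (hxμ _).le
  obtain ⟨p, rfl⟩ : ∃ p, y = reflAt e lam p := ⟨_, (reflAt_reflAt he lam y).symm⟩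
  rw [reflAt_reflAt he] at hxl hlimx
  have hpG : p ∈ G := hrefl p hxl hy
  have hpf : p ∈ frontier G := ⟨subset_closure hpG, fun hint => by
    obtain ⟨n, hn⟩ := (hlimx.eventually (mem_interior_iff_mem_nhds.1 hint)).exists
    exact hxG _ hn⟩
  rcases hxl.lt_or_eq with hlt | heq
  · exact h1 (sit1_of_mem_frontier he hrefl hpf hy hlt)
  rw [reflAt_of_inner_eq heq] at hlim
  obtain ⟨U, f, hU, hpU, hf, hf', hGU⟩ := hC2 p hpf
  have hmem : ∀ z ∈ U, z ∈ G ↔ f z ≤ 0 := fun z hz => by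
    have := Set.ext_iff.1 hGU z
    simpa [hz] using this
  have hne : fderiv ℝ f p e ≠ 0 := fun h0 =>
    h2 ⟨p, hpf, heq, U, f, hU, hpU, hf, hf' p hpU, hGU, h0⟩
  have hfp : ContDiffAt ℝ 2 f p := hf.contDiffAt (hU.mem_nhds hpU)
  have hs := hfp.hasStrictFDerivAt (by norm_num)
  have hxU := hlimx.eventually (hU.mem_nhds hpU)
  have hneg : fderiv ℝ f p e < 0 := by
    by_contra hge
    have hpos : 0 < fderiv ℝ f p e := lt_of_le_of_ne (not_lt.1 hge) (Ne.symm hne)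
    have hb := hs.isLittleO.bound (half_pos hpos)
    obtain ⟨n, hn, hn1, hn2⟩ := (((hlim.prodMk_nhds hlimx).eventually hb).and
      (hxU.and (hlim.eventually (hU.mem_nhds hpU)))).exists
    have hfx : 0 < f (x (φ n)) := not_le.1 fun h => hxG _ ((hmem _ hn1).2 h)
    have hfy : f (reflAt e (μ (φ n)) (x (φ n))) ≤ 0 := (hmem _ hn2).1 (hRG _)
    have hd : reflAt e (μ (φ n)) (x (φ n)) - x (φ n) =
        (2 * (μ (φ n) - ⟪x (φ n), e⟫)) • e := by
      simp only [reflAt]; module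
    have ht := hxμ (φ n)
    simp only [Function.comp_apply, hd, map_smul, norm_smul, he, Real.norm_eq_abs,
      smul_eq_mul, mul_one] at hn
    rw [abs_of_pos (a := 2 * (μ (φ n) - ⟪x (φ n), e⟫)) (by linarith)] at hn
    have := (abs_le.1 hn).1
    nlinarith [mul_pos hpos (sub_pos.2 ht)]
  have hfp0 : f p = 0 := by
    refine le_antisymm ((hmem p hpU).1 hpG) (ge_of_tendsto
      (hfp.continuousAt.tendsto.comp hlimx) ?_)
    filter_upwards [hxU] with n hn
    exact (not_le.1 fun h => hxG _ ((hmem _ hn).2 h)).le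
  have hline : HasDerivAt (fun t : ℝ => p + t • e) e 0 := by
    simpa using ((hasDerivAt_id (0 : ℝ)).smul_const e).const_add p
  have hder : HasDerivAt (fun t : ℝ => f (p + t • e)) (fderiv ℝ f p e) 0 := by
    refine HasFDerivAt.comp_hasDerivAt (0 : ℝ) ?_ hline
    simpa using hs.hasFDerivAt
  have hsign := eventually_nhdsWithin_sign_eq_of_deriv_neg (by rwa [hder.deriv])
    (show f (p + (0 : ℝ) • e) = 0 by simpa using hfp0)
  have hUl : ∀ᶠ t : ℝ in 𝓝 0, p + t • e ∈ U :=
    hline.continuousAt.eventually (hU.mem_nhds (by simpa using hpU))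
  have hev := hsign.and hUl
  have hev' := (continuous_neg.tendsto' (0 : ℝ) 0 neg_zero).eventually hev
  obtain ⟨t, ⟨⟨hs1, hU1⟩, hs2, hU2⟩, ht⟩ :=
    ((hev.and hev').filter_mono nhdsWithin_le_nhds).and
      (eventually_mem_nhdsWithin (a := (0 : ℝ)) (s := Ioi 0)) |>.exists
  have ht0 : (0 : ℝ) < t := ht
  rw [zero_sub, sign_neg (neg_lt_zero.2 ht0)] at hs1
  rw [zero_sub, neg_neg, sign_pos ht0, sign_eq_one_iff] at hs2
  rw [sign_eq_neg_one_iff] at hs1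
  refine (not_le.2 hs2) ((hmem _ hU2).1 (hrefl _ ?_ ?_))
  · rw [inner_add_left, heq, real_inner_smul_left, real_inner_self_eq_norm_sq, he]
    linarith
  · have : reflAt e lam (p + (-t) • e) = p + t • e := by
      rw [reflAt, inner_add_left, heq, real_inner_smul_left, real_inner_self_eq_norm_sq, he]
      module
    rw [this]
    exact (hmem _ hU1).2 hs1.le

end Geometry

/-! ### Minima of the antisymmetric difference -/

section Extrema

variable {d : ℕ} {e : Rd d}

lemma tendsto_reflAt_cocompact (he : ‖e‖ = 1) (lam : ℝ) :
    Tendsto (reflAt e lam) (cocompact (Rd d)) (cocompact (Rd d)) :=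
  (Homeomorph.mk ⟨reflAt e lam, reflAt e lam, reflAt_reflAt he lam, reflAt_reflAt he lam⟩
    (continuous_reflAt_right lam)
    (continuous_reflAt_right lam)).isClosedEmbedding.tendsto_cocompact

/-- If `u - u ∘ R` is negative somewhere in the half-space, then it has a negative minimum. -/
lemma exists_isMin_neg (he : ‖e‖ = 1) {u : Rd d → ℝ} (hu : Continuous u)
    (hdecay : Tendsto u (cocompact (Rd d)) (𝓝 0)) {lam : ℝ} {x₀ : Rd d} (hx₀ : ⟪x₀, e⟫ < lam)
    (hneg : u x₀ - u (reflAt e lam x₀) < 0) :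
    ∃ x, ⟪x, e⟫ < lam ∧ u x - u (reflAt e lam x) < 0 ∧
      ∀ y, ⟪y, e⟫ < lam → u x - u (reflAt e lam x) ≤ u y - u (reflAt e lam y) := by
  have hvc : Continuous fun y => u y - u (reflAt e lam y) :=
    hu.sub (hu.comp (continuous_reflAt_right lam))
  have hv0 : Tendsto (fun y => u y - u (reflAt e lam y)) (cocompact (Rd d)) (𝓝 0) := by
    simpa using hdecay.sub (hdecay.comp (tendsto_reflAt_cocompact he lam))
  obtain ⟨x, hx, hmin⟩ := hvc.continuousOn.exists_isMinOn'
    (s := {y : Rd d | ⟪y, e⟫ ≤ lam}) (isClosed_le (by fun_prop) continuous_const) hx₀.le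
    (((hv0.eventually (lt_mem_nhds hneg)).mono fun _ h => h.le).filter_mono inf_le_left)
  have hxneg : u x - u (reflAt e lam x) < 0 := (hmin hx₀.le).trans_lt hneg
  refine ⟨x, lt_of_le_of_ne hx fun h => ?_, hxneg, fun y hy => hmin hy.le⟩
  rw [reflAt_of_inner_eq h, sub_self] at hxneg
  exact hxneg.false

lemma uniformContinuous_of_holder {u : Rd d → ℝ} {β C : ℝ} (hβ : 0 < β)
    (h : ∀ x y, |u x - u y| ≤ C * ‖x - y‖ ^ β) : UniformContinuous u := by
  rw [Metric.uniformContinuous_iff]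
  intro ε hε
  have hlim : Tendsto (fun t : ℝ => C * t ^ β) (𝓝 0) (𝓝 0) :=
    ((Real.continuous_rpow_const hβ.le).const_mul C).tendsto' 0 0 (by
      simp [Real.zero_rpow hβ.ne'])
  obtain ⟨δ, hδ, hlt⟩ := Metric.eventually_nhds_iff.1 (hlim.eventually (gt_mem_nhds hε))
  refine ⟨δ, hδ, fun x y hxy => ?_⟩
  rw [Real.dist_eq]
  refine (h x y).trans_lt (hlt ?_)
  simpa [dist_eq_norm] using hxy

end Extrema

/-- **Lemma 4.3** (degenerate critical position forces symmetry): in the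
setting of Theorem 2.3, if `λ* > λ₀` then `v_{λ*} ≡ 0` on `ℝ^d`, i.e. `u` is
symmetric with respect to the hyperplane `{x·e = λ*}`. -/
theorem moving_plane_degenerate_symmetry
    {d : ℕ} (hd : 2 ≤ d) (S : PsiSetting d) (hker : S.kernelCond)
    (V : ℝ → ℝ) (hV : IsRenewal S.Ψ V)
    (n : ℕ) (hn : 0 < n) (G : Fin n → Set (Rd d))
    (hGc : ∀ k, IsCompact (G k)) (hGconn : ∀ k, IsConnected (G k))
    (hGC2 : ∀ k, HasC2BoundaryClosed (G k))
    (hGdisj : ∀ k l, k ≠ l → Disjoint (G k) (G l))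
    (A : ℝ) (hA : 0 < A)
    (f : ℝ → ℝ) (hf : ∃ L : ℝ≥0, LipschitzOnWith L f (Set.Icc 0 A))
    (f₀ : ℝ) (hf₀ : 0 < f₀ ∧ f₀ ≤ A) (hmono : AntitoneOn f (Set.Icc 0 f₀))
    (Ak : Fin n → ℝ) (hAk : ∀ k, Ak k ≤ 0)
    (u : Rd d → ℝ)
    (β : ℝ) (hβ : 0 < β ∧ β < 1)
    (hHolder : ∃ C > (0:ℝ), ∀ x y, |u x - u y| ≤ C * ‖x - y‖ ^ β)
    (hsol : IsSol S ((⋃ k, G k)ᶜ) (fun _ => 0) (fun x => f (u x)) u)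
    (hG : ∀ x ∈ ⋃ k, G k, u x = A)
    (htr : ∀ k, ∀ x ∈ frontier (G k),
      HasVTrace V ((⋃ k, G k)ᶜ) (fun z => u z - A) x (Ak k))
    (hbound : ∀ x ∉ ⋃ k, G k, 0 ≤ u x ∧ u x < A)
    (hdecay : Filter.Tendsto u (Filter.cocompact (Rd d)) (nhds 0))
    (e : Rd d) (he : ‖e‖ = 1)
    (lam₀ : ℝ)
    (hlam₀ : IsGreatest
      {lam : ℝ | Sit1 (⋃ k, G k) e lam ∨ Sit2 (⋃ k, G k) e lam} lam₀)
    (lamStar : ℝ)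
    (hlamStar : lamStar = sInf {lam : ℝ | lam₀ ≤ lam ∧
      ∀ μ : ℝ, lam < μ → ∀ x : Rd d, ⟪x, e⟫ < μ → 0 ≤ u x - u (reflAt e μ x)})
    (hgt : lam₀ < lamStar) :
    ∀ x : Rd d, u x = u (reflAt e lamStar x) := by
  have hd0 : 0 < d := by omega
  obtain ⟨L, hL⟩ := hf
  obtain ⟨C, -, hC⟩ := hHolder
  have huu : UniformContinuous u := uniformContinuous_of_holder hβ.1 hC
  have huc := huu.continuous
  have hcomp : IsCompact (⋃ k, G k) := isCompact_iUnion hGc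
  have hC2 : HasC2BoundaryClosed (⋃ k, G k) :=
    hasC2BoundaryClosed_iUnion (fun k => (hGc k).isClosed) hGC2 hGdisj
  have hΩ : IsOpen (⋃ k, G k)ᶜ := hcomp.isClosed.isOpen_compl
  generalize (⋃ k, G k) = GU at *
  have hu01 : ∀ x, u x ∈ Icc 0 A := fun x => by
    by_cases hx : x ∈ GU
    · rw [hG x hx]
      exact ⟨hA.le, le_rfl⟩
    · exact ⟨(hbound x hx).1, (hbound x hx).2.le⟩
  have hmem : ∀ x, A ≤ u x → x ∈ GU := fun x hx => by
    by_contra hxG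
    exact (hbound x hxG).2.not_ge hx
  have hM : ∀ y, |u y| ≤ A := fun y => by
    rw [abs_of_nonneg (hu01 y).1]
    exact (hu01 y).2
  have hg : Continuous fun x => f (u x) := hL.continuousOn.comp_continuous huc hu01
  obtain ⟨R₀, -, hR₀⟩ := (hasBasis_cobounded_norm (E := Rd d)).eventually_iff.1
    ((Metric.cobounded_eq_cocompact (α := Rd d)).symm ▸ hdecay.eventually (gt_mem_nhds hf₀.1))
  have hnot : ∀ μ x, u x - u (reflAt e μ x) < 0 → x ∉ GU := fun μ x hneg hxG => by
    have := hG x hxG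
    have := (hu01 (reflAt e μ x)).2
    linarith
  have hfar : ∀ μ x, ⟪x, e⟫ < μ → u x - u (reflAt e μ x) < 0 →
      (∀ y, ⟪y, e⟫ < μ → u x - u (reflAt e μ x) ≤ u y - u (reflAt e μ y)) →
      ‖reflAt e μ x‖ ≤ R₀ := by
    intro μ x hxμ hneg hmin
    by_contra hlt
    have hsmall : u (reflAt e μ x) < f₀ := hR₀ (not_le.1 hlt).le
    have hRG : reflAt e μ x ∉ GU := fun h => by
      have := hG _ h
      linarith [hf₀.2]
    have h1 := S.sub_le_mul_of_isMin_neg hd0 hΩ huu hg hM hsol he (hnot μ x hneg) hRG hxμ hneg hmin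
    have h2 := mul_neg_of_neg_of_pos hneg
      (S.setIntegral_j_halfSpace_pos hd0 he (sub_pos.2 hxμ))
    have h3 := hmono (a := u x) ⟨(hu01 _).1, by linarith⟩ ⟨(hu01 _).1, hsmall.le⟩ (by linarith)
    linarith
  set T := {lam : ℝ | lam₀ ≤ lam ∧
    ∀ μ : ℝ, lam < μ → ∀ x : Rd d, ⟪x, e⟫ < μ → 0 ≤ u x - u (reflAt e μ x)} with hT
  have hTne : T.Nonempty := by
    refine ⟨max lam₀ R₀, le_max_left _ _, fun μ hμ x₀ hx₀ => ?_⟩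
    by_contra hneg
    obtain ⟨x, hxμ, hxneg, hmin⟩ := exists_isMin_neg he huc hdecay hx₀ (not_le.1 hneg)
    have h1 := hfar μ x hxμ hxneg hmin
    have h2 := real_inner_le_norm (reflAt e μ x) e
    rw [inner_reflAt he, he, mul_one] at h2
    linarith [(max_lt_iff.1 hμ).2]
  have hTbdd : BddBelow T := ⟨lam₀, fun _ h => h.1⟩
  have hstar : ∀ μ : ℝ, lamStar < μ → ∀ x : Rd d, ⟪x, e⟫ < μ →
      0 ≤ u x - u (reflAt e μ x) := by
    intro μ hμ
    obtain ⟨lam, hlam, hlt⟩ := exists_lt_of_csInf_lt hTne (hlamStar ▸ hμ)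
    exact hlam.2 μ hlt
  have hcont : Continuous fun p : ℝ × Rd d => u p.2 - u (reflAt e p.1 p.2) :=
    (huc.comp continuous_snd).sub (huc.comp continuous_reflAt)
  have hstar0 : ∀ x : Rd d, ⟪x, e⟫ ≤ lamStar → 0 ≤ u x - u (reflAt e lamStar x) := by
    intro x hx
    have hlim : Tendsto (fun μ : ℝ => u x - u (reflAt e μ x)) (𝓝[>] lamStar)
        (𝓝 (u x - u (reflAt e lamStar x))) :=
      ((hcont.comp (Continuous.prodMk_left x)).tendsto lamStar).mono_left nhdsWithin_le_nhds
    refine ge_of_tendsto hlim ?_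
    filter_upwards [self_mem_nhdsWithin] with μ hμ
    exact hstar μ hμ x (lt_of_le_of_lt hx hμ)
  have hrefl : ∀ x, ⟪x, e⟫ ≤ lamStar → reflAt e lamStar x ∈ GU → x ∈ GU := fun x hx hRx =>
    hmem x (by linarith [hstar0 x hx, hG _ hRx])
  have hs1 : ¬ Sit1 GU e lamStar := fun h => (hlam₀.2 (Or.inl h)).not_gt hgt
  have hs2 : ¬ Sit2 GU e lamStar := fun h => (hlam₀.2 (Or.inr h)).not_gt hgt
  have hfreq : ∃ᶠ μ in 𝓝 lamStar, ∃ x, ⟪x, e⟫ < μ ∧ u x - u (reflAt e μ x) < 0 ∧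
      ∀ y, ⟪y, e⟫ < μ → u x - u (reflAt e μ x) ≤ u y - u (reflAt e μ y) := by
    intro hev
    obtain ⟨ε, hε, h⟩ := Metric.eventually_nhds_iff.1 hev
    obtain ⟨lam, hl1, hl2⟩ := exists_between (max_lt hgt (sub_lt_self lamStar hε))
    have hlT : lam ∉ T := notMem_of_lt_csInf (hlamStar ▸ hl2) hTbdd
    rw [hT, mem_ofPred_eq, not_and] at hlT
    have := hlT (max_lt_iff.1 hl1).1.le
    push Not at this
    obtain ⟨μ, hμ, x₀, hx₀, hneg⟩ := this
    have hμle : μ ≤ lamStar := by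
      by_contra hlt
      exact (hstar μ (not_le.1 hlt) x₀ hx₀).not_gt hneg
    refine h (y := μ) ?_ (exists_isMin_neg he huc hdecay hx₀ hneg)
    rw [Real.dist_eq, abs_lt]
    constructor <;> linarith [(max_lt_iff.1 hl1).2]
  obtain ⟨μ, hμ, hμx⟩ := exists_seq_forall_of_frequently (hfreq.and_eventually
    ((eventually_reflAt_notMem hcomp hC2 he hs1 hs2 hrefl).and
      (continuous_abs.continuousAt.eventually (gt_mem_nhds (lt_add_one |lamStar|)))))
  choose hmins hRnot hμb using hμx
  choose x hxμ hxneg hxmin using hmins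
  have hxG : ∀ n, x n ∉ GU := fun n => hnot _ _ (hxneg n)
  obtain ⟨δ₀, hδ₀, hLδ⟩ := S.exists_lt_setIntegral_j_halfSpace hd0 he L
  have hxδ : ∀ n, δ₀ ≤ μ n - ⟪x n, e⟫ := by
    intro n
    by_contra hlt
    have h1 := S.sub_le_mul_of_isMin_neg hd0 hΩ huu hg hM hsol he (hxG n)
      (hRnot n _ (hxμ n) (hxG n)) (hxμ n) (hxneg n) (hxmin n)
    have h2 := S.setIntegral_j_halfSpace_anti hd0 he (sub_pos.2 (hxμ n)) (not_le.1 hlt).le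
    have h3 := hL.dist_le_mul _ (hu01 (x n)) _ (hu01 (reflAt e (μ n) (x n)))
    rw [Real.dist_eq, Real.dist_eq, abs_of_neg (hxneg n)] at h3
    have h4 := (abs_le.1 h3).1
    have h5 := hxneg n
    nlinarith
  have hxb : ∀ n, x n ∈ closedBall (0 : Rd d) (R₀ + 2 * (|lamStar| + 1)) := by
    intro n
    rw [mem_closedBall_zero_iff]
    have h1 := norm_le_norm_reflAt he (μ n) (x n)
    have h2 := hfar _ _ (hxμ n) (hxneg n) (hxmin n)
    have h3 : |μ n| < |lamStar| + 1 := hμb n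
    linarith
  obtain ⟨p, -, φ, hφ, hlim⟩ := (isCompact_closedBall _ _).tendsto_subseq hxb
  have hμφ : Tendsto (fun n => μ (φ n)) atTop (𝓝 lamStar) := hμ.comp hφ.tendsto_atTop
  have hpl : ⟪p, e⟫ < lamStar := by
    have h := ge_of_tendsto' (hμφ.sub (hlim.inner tendsto_const_nhds)) fun n => hxδ (φ n)
    linarith
  have hp0 : u p = u (reflAt e lamStar p) := by
    have h := le_of_tendsto' ((hcont.tendsto (lamStar, p)).comp (hμφ.prodMk_nhds hlim))
      fun n => (hxneg (φ n)).le
    have h' := hstar0 p hpl.le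
    simp only at h
    linarith
  have hpG : p ∉ GU := by
    intro hpG
    refine hs1 (sit1_of_mem_frontier he hrefl ⟨subset_closure hpG, fun hint => ?_⟩
      (hmem _ (by rw [← hp0, hG p hpG])) hpl)
    obtain ⟨n, hn⟩ := (hlim.eventually (mem_interior_iff_mem_nhds.1 hint)).exists
    exact hxG _ hn
  have hRpG : reflAt e lamStar p ∉ GU := fun h => hpG (hmem _ (by rw [hp0, hG _ h]))
  exact S.eq_reflAt_of_isMin_zero hd0 hΩ huu hg hM hsol he hpG hRpG hpl hp0
    (congrArg f hp0) fun y hy => hstar0 y hy.le
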